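/- The fundamental group π₁𝒰ℛ^<_n of the space of configurations of untwisted rings of pairwise unequal sizes is isomorphic to the group with presentation having generators α_{ij} for 1 ≤ i < j ≤ n and relations α_{ij}α_{kℓ} = α_{kℓ}α_{ij}, α_{ik}α_{jk} = α_{jk}α_{ik}, and α_{ij}α_{ik}α_{jk} = α_{jk}α_{ik}α_{ij}, where distinct index symbols denote distinct numbers and only relations involving generators α_{ij} with i < j are imposed. -/

import Mathlib

noncomputable section

open CategoryTheory

abbrev E2 : Type := EuclideanSpace ℝ (Fin 2)
abbrev E3 : Type := EuclideanSpace ℝ (Fin 3)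

/-- The round circle in `ℝ³` with center `c`, radius `r` and normal `v`. -/
def circleSet (c : E3) (r : ℝ) (v : E3) : Set E3 :=
  {x | ‖x - c‖ = r ∧ inner ℝ (x - c) v = (0 : ℝ)}

/-- The spanning disk of the round circle with center `c`, radius `r` and normal `v`. -/
def diskSet (c : E3) (r : ℝ) (v : E3) : Set E3 :=
  {x | ‖x - c‖ ≤ r ∧ inner ℝ (x - c) v = (0 : ℝ)}

/-- The circle determined by a parameter pair (center, normal vector `w`):
it has radius `‖w‖` and unit normal `w / ‖w‖` (so `w` and `-w` give the same circle). -/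
def pCircle (p : E3 × E3) : Set E3 := circleSet p.1 ‖p.2‖ p.2

/-- The spanning disk of the circle determined by a parameter pair. -/
def pDisk (p : E3 × E3) : Set E3 := diskSet p.1 ‖p.2‖ p.2

/-- The first circle meets the spanning disk of the second in exactly one point. -/
def LinksOnce (p q : E3 × E3) : Prop := ∃! x, x ∈ pCircle p ∩ pDisk q

/-- Two round circles are unlinked if neither meets the spanning disk of the other in
exactly one point. -/
def UnlinkedPair (p q : E3 × E3) : Prop := ¬ LinksOnce p q ∧ ¬ LinksOnce q p

/-- An `n`-tuple of parameters of (nondegenerate) pairwise disjoint, pairwise unlinked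
round circles. -/
def IsRingTuple {n : ℕ} (f : Fin n → E3 × E3) : Prop :=
  (∀ i, (f i).2 ≠ 0) ∧
  (∀ i j, i ≠ j → Disjoint (pCircle (f i)) (pCircle (f j))) ∧
  (∀ i j, i ≠ j → UnlinkedPair (f i) (f j))

/-- The space of ordered `n`-tuples of disjoint pairwise unlinked round circles. -/
abbrev RingTuple (n : ℕ) : Type := {f : Fin n → E3 × E3 // IsRingTuple f}

/-- Two tuples are identified iff they determine the same `n`-element set of circles
(this identifies `w` with `-w` and permutes the circles). -/
def ringSetoid (n : ℕ) : Setoid (RingTuple n) where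
  r f g := (Set.range fun i => pCircle (f.1 i)) = Set.range fun i => pCircle (g.1 i)
  iseqv := ⟨fun _ => rfl, Eq.symm, Eq.trans⟩

/-- The space `ℛ_n` of configurations of `n` disjoint pairwise unlinked round circles
in `ℝ³`, with the quotient topology. -/
abbrev RingConf (n : ℕ) : Type := Quotient (ringSetoid n)

/-- All circles of the tuple lie in planes parallel to the `yz`-plane, i.e. every
normal vector is parallel to `(1,0,0)`. -/
def IsUntwistedTuple {n : ℕ} (f : RingTuple n) : Prop :=
  ∀ i, (f.1 i).2 1 = 0 ∧ (f.1 i).2 2 = 0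

/-- All circles of the tuple lie in vertical planes, i.e. every normal vector is
horizontal (third coordinate zero). -/
def IsVerticalTuple {n : ℕ} (f : RingTuple n) : Prop := ∀ i, (f.1 i).2 2 = 0

/-- The untwisted ring space `𝒰ℛ_n ⊆ ℛ_n`: configurations of rings parallel to the
`yz`-plane. -/
def URConf (n : ℕ) : Set (RingConf n) :=
  {x | ∃ f, Quotient.mk (ringSetoid n) f = x ∧ IsUntwistedTuple f}

/-- The vertical ring space `𝒱ℛ_n ⊆ ℛ_n`: configurations of rings in vertical planes. -/
def VRConf (n : ℕ) : Set (RingConf n) :=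
  {x | ∃ f, Quotient.mk (ringSetoid n) f = x ∧ IsVerticalTuple f}

/-- The subspace `𝒰ℛ^<_n ⊆ 𝒰ℛ_n` of configurations of untwisted rings of pairwise
distinct radii. -/
def URlt (n : ℕ) : Set (RingConf n) :=
  {x | ∃ f, Quotient.mk (ringSetoid n) f = x ∧ IsUntwistedTuple f ∧
    Function.Injective fun i => ‖(f.1 i).2‖}

/-- Generators `α_{ij}`, `i < j`. -/
abbrev AltGen (n : ℕ) : Type := {p : Fin n × Fin n // p.1 < p.2}

/-- The generator `α_{ij}` for `i < j`. -/
def gβ {n : ℕ} (i j : Fin n) (h : i < j) : FreeGroup (AltGen n) := FreeGroup.of ⟨(i, j), h⟩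

/-- The relations `α_{ij}α_{kℓ} = α_{kℓ}α_{ij}`, `α_{ik}α_{jk} = α_{jk}α_{ik}` and
`α_{ij}α_{ik}α_{jk} = α_{jk}α_{ik}α_{ij}` (distinct symbols denoting distinct indices),
restricted to the generators `α_{ij}` with `i < j`, written as relators. -/
def urltRels (n : ℕ) : Set (FreeGroup (AltGen n)) :=
  (⋃ (i : Fin n) (j : Fin n) (k : Fin n) (l : Fin n) (hij : i < j) (hkl : k < l)
      (_ : i ≠ k) (_ : i ≠ l) (_ : j ≠ k) (_ : j ≠ l),
    {gβ i j hij * gβ k l hkl * (gβ k l hkl * gβ i j hij)⁻¹}) ∪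
  (⋃ (i : Fin n) (j : Fin n) (k : Fin n) (hik : i < k) (hjk : j < k) (_ : i ≠ j),
    {gβ i k hik * gβ j k hjk * (gβ j k hjk * gβ i k hik)⁻¹}) ∪
  (⋃ (i : Fin n) (j : Fin n) (k : Fin n) (hij : i < j) (hik : i < k) (hjk : j < k),
    {gβ i j hij * gβ i k hik * gβ j k hjk * (gβ j k hjk * gβ i k hik * gβ i j hij)⁻¹})

namespace UR

/-- Parameter space: `x`-coordinates, `yz`-centers, radii. -/
abbrev Cfg (n : ℕ) : Type := (Fin n → ℝ) × (Fin n → ℂ) × (Fin n → ℝ)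

/-- The model: disjoint circles sorted by radius. -/
def XSet (n : ℕ) : Set (Cfg n) :=
  {p | (∀ i, 0 < p.2.2 i) ∧ StrictMono p.2.2 ∧ ∀ i j, i < j → p.1 i = p.1 j →
    ‖p.2.1 i - p.2.1 j‖ < p.2.2 j - p.2.2 i ∨ p.2.2 i + p.2.2 j < ‖p.2.1 i - p.2.1 j‖}

abbrev XT (n : ℕ) : Type := ↥(XSet n)

/-- real dot product on `ℂ` -/
def dot (u z : ℂ) : ℝ := u.re * z.re + u.im * z.im

lemma dot_le (u z : ℂ) (hu : ‖u‖ = 1) : dot u z ≤ ‖z‖ := by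
  have h : dot u z = (starRingEnd ℂ u * z).re := by
    simp [dot]
  rw [h]
  calc _ ≤ ‖starRingEnd ℂ u * z‖ := Complex.re_le_norm _
    _ = ‖z‖ := by rw [norm_mul, RCLike.norm_conj, hu, one_mul]

/-- The possible open convex conditions on a pair. -/
inductive Cond where
  | lt | gt | inn | out (u : ℂ)

def Cond.Holds (c : Cond) (xi xj : ℝ) (zi zj : ℂ) (ri rj : ℝ) : Prop :=
  match c with
  | .lt => xi < xj
  | .gt => xj < xi
  | .inn => ‖zi - zj‖ < rj - ri
  | .out u => ‖u‖ = 1 ∧ ri + rj < dot u (zi - zj)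

def Cell {n : ℕ} (a : Fin n → Fin n → Cond) : Set (Cfg n) :=
  {p | (∀ i, 0 < p.2.2 i) ∧ StrictMono p.2.2 ∧ ∀ i j, i < j →
    (a i j).Holds (p.1 i) (p.1 j) (p.2.1 i) (p.2.1 j) (p.2.2 i) (p.2.2 j)}

variable {n : ℕ}

lemma Cell_subset (a : Fin n → Fin n → Cond) : Cell a ⊆ XSet n := by
  rintro p ⟨h0, h1, h2⟩
  refine ⟨h0, h1, fun i j hij hx => ?_⟩
  have h := h2 i j hij
  rcases ha : a i j with _ | _ | _ | u <;> rw [ha] at h <;> simp only [Cond.Holds] at h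
  · exact absurd hx h.ne
  · exact absurd hx h.ne'
  · exact Or.inl h
  · exact Or.inr (h.2.trans_le (dot_le u _ h.1))

lemma Cond.Holds.convex (c : Cond) {xi xj yi yj : ℝ} {zi zj wi wj : ℂ} {ri rj si sj : ℝ}
    (h1 : c.Holds xi xj zi zj ri rj) (h2 : c.Holds yi yj wi wj si sj) {s t : ℝ}
    (hs : 0 ≤ s) (ht : 0 ≤ t) (hst : s + t = 1) :
    c.Holds (s * xi + t * yi) (s * xj + t * yj) (s • zi + t • wi) (s • zj + t • wj)
      (s * ri + t * si) (s * rj + t * sj) := by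
  have key : ∀ a b : ℝ, 0 < a → 0 < b → 0 < s * a + t * b := by
    intro a b ha hb
    rcases hs.eq_or_lt with h | h
    · subst h; have : t = 1 := by linarith
      subst this; simpa using hb
    · have := mul_pos h ha; have := mul_nonneg ht hb.le; linarith
  rcases c with _ | _ | _ | u <;> simp only [Cond.Holds] at *
  · have := key _ _ (sub_pos.2 h1) (sub_pos.2 h2); linarith
  · have := key _ _ (sub_pos.2 h1) (sub_pos.2 h2); linarith
  · have h3 := key _ _ (sub_pos.2 h1) (sub_pos.2 h2)
    have h4 : ‖s • zi + t • wi - (s • zj + t • wj)‖ ≤ s * ‖zi - zj‖ + t * ‖wi - wj‖ := by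
      have : s • zi + t • wi - (s • zj + t • wj) = s • (zi - zj) + t • (wi - wj) := by
        simp only [smul_sub]; abel
      rw [this]
      refine (norm_add_le _ _).trans ?_
      rw [norm_smul, norm_smul, Real.norm_of_nonneg hs, Real.norm_of_nonneg ht]
    linarith
  · refine ⟨h1.1, ?_⟩
    have h3 := key _ _ (sub_pos.2 h1.2) (sub_pos.2 h2.2)
    have : dot u (s • zi + t • wi - (s • zj + t • wj))
        = s * dot u (zi - zj) + t * dot u (wi - wj) := by
      simp [dot]; ring
    rw [this]; linarith

lemma Cell_convex (a : Fin n → Fin n → Cond) : Convex ℝ (Cell a) := by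
  rintro p ⟨h0, h1, h2⟩ q ⟨k0, k1, k2⟩ s t hs ht hst
  have key : ∀ a b : ℝ, 0 < a → 0 < b → 0 < s * a + t * b := by
    intro a b ha hb
    rcases hs.eq_or_lt with h | h
    · subst h; have : t = 1 := by linarith
      subst this; simpa using hb
    · have := mul_pos h ha; have := mul_nonneg ht hb.le; linarith
  refine ⟨fun i => ?_, fun i j hij => ?_, fun i j hij => ?_⟩
  · simpa using key _ _ (h0 i) (k0 i)
  · have := key _ _ (sub_pos.2 (h1 hij)) (sub_pos.2 (k1 hij))
    simp; linarith
  · exact (h2 i j hij).convex _ (k2 i j hij) hs ht hst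

lemma strictMono_open : IsOpen {p : Cfg n | (∀ i, 0 < p.2.2 i) ∧ StrictMono p.2.2} := by
  have : {p : Cfg n | (∀ i, 0 < p.2.2 i) ∧ StrictMono p.2.2} =
    (⋂ i, {p : Cfg n | 0 < p.2.2 i}) ∩ ⋂ i, ⋂ j, {p : Cfg n | i < j → p.2.2 i < p.2.2 j} := by
    ext p; simp [StrictMono]
  rw [this]
  refine IsOpen.inter (isOpen_iInter_of_finite fun i => isOpen_lt (by fun_prop) (by fun_prop))
    (isOpen_iInter_of_finite fun i => isOpen_iInter_of_finite fun j => ?_)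
  by_cases h : i < j
  · simp only [h, true_imp_iff]
    exact isOpen_lt (by fun_prop) (by fun_prop)
  · simp [h]

lemma Cell_open (a : Fin n → Fin n → Cond) : IsOpen (Cell a) := by
  have : Cell a = {p : Cfg n | (∀ i, 0 < p.2.2 i) ∧ StrictMono p.2.2} ∩
      ⋂ i, ⋂ j, {p : Cfg n | i < j →
        (a i j).Holds (p.1 i) (p.1 j) (p.2.1 i) (p.2.1 j) (p.2.2 i) (p.2.2 j)} := by
    ext p; simp [Cell, and_assoc]
  rw [this]
  refine strictMono_open.inter
    (isOpen_iInter_of_finite fun i => isOpen_iInter_of_finite fun j => ?_)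
  by_cases h : i < j
  · simp only [h, true_imp_iff]
    rcases a i j with _ | _ | _ | u <;> simp only [Cond.Holds]
    · exact isOpen_lt (by fun_prop) (by fun_prop)
    · exact isOpen_lt (by fun_prop) (by fun_prop)
    · exact isOpen_lt (by fun_prop) (by fun_prop)
    · refine (isOpen_const).and (isOpen_lt (by fun_prop) ?_)
      simp only [dot]
      have h1 : Continuous fun p : Cfg n => p.2.1 i - p.2.1 j := by fun_prop
      exact (continuous_const.mul (Complex.continuous_re.comp h1)).add
        (continuous_const.mul (Complex.continuous_im.comp h1))
  · simp [h]

/-- unit direction -/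
def dir (z : ℂ) : ℂ := z / (‖z‖ : ℂ)

lemma norm_dir {z : ℂ} (h : 0 < ‖z‖) : ‖dir z‖ = 1 := by
  simp [dir, h.ne']

lemma dot_dir {z : ℂ} (h : 0 < ‖z‖) : dot (dir z) z = ‖z‖ := by
  have h2 : ‖z‖ * ‖z‖ = z.re * z.re + z.im * z.im := by
    rw [Complex.norm_mul_self_eq_normSq, Complex.normSq_apply]
  have hre : (dir z).re = z.re / ‖z‖ := by simp [dir, Complex.div_ofReal_re]
  have him : (dir z).im = z.im / ‖z‖ := by simp [dir, Complex.div_ofReal_im]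
  rw [dot, hre, him]
  field_simp
  nlinarith

lemma exists_cell {p : Cfg n} (hp : p ∈ XSet n) : ∃ a, p ∈ Cell a := by
  obtain ⟨h0, h1, h2⟩ := hp
  have : ∀ i j, ∃ c : Cond, i < j →
      c.Holds (p.1 i) (p.1 j) (p.2.1 i) (p.2.1 j) (p.2.2 i) (p.2.2 j) := by
    intro i j
    by_cases hij : i < j
    · rcases lt_trichotomy (p.1 i) (p.1 j) with h | h | h
      · exact ⟨.lt, fun _ => h⟩
      · rcases h2 i j hij h with h | h
        · exact ⟨.inn, fun _ => h⟩
        · have hz : 0 < ‖p.2.1 i - p.2.1 j‖ := by linarith [h0 i, h0 j]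
          exact ⟨.out (dir (p.2.1 i - p.2.1 j)), fun _ => ⟨norm_dir hz, by rwa [dot_dir hz]⟩⟩
      · exact ⟨.gt, fun _ => h⟩
    · exact ⟨.lt, fun h => absurd h hij⟩
  choose a ha using this
  exact ⟨a, h0, h1, fun i j h => ha i j h⟩

/-! ### straight line paths -/

/-- Two paths inside a convex subset of `XSet n` are homotopic. -/
lemma homotopic_of_convex {S : Set (Cfg n)} (hS : Convex ℝ S) (hSX : S ⊆ XSet n) {p q : XT n}
    (γ γ' : Path p q) (h : ∀ t, (γ t).1 ∈ S) (h' : ∀ t, (γ' t).1 ∈ S) : γ.Homotopic γ' := by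
  have hmem : ∀ (s t : unitInterval), (1 - (s : ℝ)) • (γ t).1 + (s : ℝ) • (γ' t).1 ∈ S :=
    fun s t => hS (h t) (h' t) (by linarith [s.2.2]) s.2.1 (by ring)
  refine ⟨⟨⟨⟨fun x => ⟨_, hSX (hmem x.1 x.2)⟩, ?_⟩, ?_, ?_⟩, ?_⟩⟩
  · refine Continuous.subtype_mk ?_ _
    fun_prop
  · intro t; ext1; simp
  · intro t; ext1; simp
  · intro s t ht
    rcases ht with rfl | ht
    · ext1; simp [← add_smul]
    · rw [Set.mem_singleton_iff] at ht; subst ht; ext1; simp [← add_smul]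

def segPath {S : Set (Cfg n)} (hS : Convex ℝ S) (hSX : S ⊆ XSet n) {p q : XT n}
    (hp : p.1 ∈ S) (hq : q.1 ∈ S) : Path p q where
  toFun t := ⟨(1 - (t : ℝ)) • p.1 + (t : ℝ) • q.1,
    hSX (hS hp hq (by linarith [t.2.2]) t.2.1 (by ring))⟩
  continuous_toFun := by
    refine Continuous.subtype_mk ?_ _
    fun_prop
  source' := by ext1; simp
  target' := by ext1; simp

lemma segPath_mem {S : Set (Cfg n)} (hS : Convex ℝ S) (hSX : S ⊆ XSet n) {p q : XT n}
    (hp : p.1 ∈ S) (hq : q.1 ∈ S) (t) : (segPath hS hSX hp hq t).1 ∈ S :=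
  hS hp hq (by linarith [t.2.2]) t.2.1 (by ring)

abbrev CoCell (p q : XT n) : Prop := ∃ a, p.1 ∈ Cell a ∧ q.1 ∈ Cell a

abbrev fg (p : XT n) : FundamentalGroupoid (XT n) := FundamentalGroupoid.mk p

/-- straight line class -/
def sc {p q : XT n} (h : CoCell p q) : fg p ⟶ fg q :=
  Path.Homotopic.Quotient.mk (segPath (Cell_convex _) (Cell_subset _) h.choose_spec.1
    h.choose_spec.2)

lemma mk_eq_sc {p q : XT n} (a) (hp : p.1 ∈ Cell a) (hq : q.1 ∈ Cell a) (γ : Path p q)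
    (h : ∀ t, (γ t).1 ∈ Cell a) :
    (Path.Homotopic.Quotient.mk γ : fg p ⟶ fg q) = sc ⟨a, hp, hq⟩ := by
  have e : Path.Homotopic.Quotient.mk γ = Path.Homotopic.Quotient.mk
      (segPath (Cell_convex a) (Cell_subset a) hp hq) :=
    Path.Homotopic.Quotient.eq.2 (homotopic_of_convex (Cell_convex a) (Cell_subset a) _ _ h
      (segPath_mem _ _ _ _))
  refine e.trans ?_
  have hc : CoCell p q := ⟨a, hp, hq⟩
  refine Path.Homotopic.Quotient.eq.2 (homotopic_of_convex (S := Cell a ∩ Cell hc.choose)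
    ((Cell_convex _).inter (Cell_convex _))
    (Set.inter_subset_left.trans (Cell_subset a)) _ _ (fun t => ?_) (fun t => ?_))
  · exact (segPath_mem ((Cell_convex a).inter (Cell_convex hc.choose))
      (Set.inter_subset_left.trans (Cell_subset a)) ⟨hp, hc.choose_spec.1⟩
      ⟨hq, hc.choose_spec.2⟩ t)
  · exact (segPath_mem ((Cell_convex a).inter (Cell_convex hc.choose))
      (Set.inter_subset_left.trans (Cell_subset a)) ⟨hp, hc.choose_spec.1⟩
      ⟨hq, hc.choose_spec.2⟩ t)

lemma sc_trans (a) {p q r : XT n} (hp : p.1 ∈ Cell a) (hq : q.1 ∈ Cell a) (hr : r.1 ∈ Cell a) :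
    sc ⟨a, hp, hq⟩ ≫ sc ⟨a, hq, hr⟩ = sc ⟨a, hp, hr⟩ := by
  rw [← mk_eq_sc a hp hq (segPath (Cell_convex a) (Cell_subset a) hp hq) (segPath_mem _ _ _ _),
    ← mk_eq_sc a hq hr (segPath (Cell_convex a) (Cell_subset a) hq hr) (segPath_mem _ _ _ _)]
  refine mk_eq_sc a hp hr ((segPath (Cell_convex a) (Cell_subset a) hp hq).trans
    (segPath (Cell_convex a) (Cell_subset a) hq hr)) (fun t => ?_)
  have ht := Set.mem_range_self (f := ((segPath (Cell_convex a) (Cell_subset a) hp hq).trans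
    (segPath (Cell_convex a) (Cell_subset a) hq hr))) t
  rw [Path.trans_range] at ht
  rcases ht with ⟨s, hs⟩ | ⟨s, hs⟩
  · rw [← hs]; exact segPath_mem _ _ _ _ s
  · rw [← hs]; exact segPath_mem _ _ _ _ s

lemma sc_self {p : XT n} (h : CoCell p p) : sc h = 𝟙 _ := by
  obtain ⟨a, hp, -⟩ := h
  have := sc_trans a hp hp hp
  rwa [← cancel_epi (sc ⟨a, hp, hp⟩), Category.comp_id]

lemma sc_inv {p q : XT n} (h : CoCell p q) (h' : CoCell q p) : inv (sc h) = sc h' := by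
  obtain ⟨a, hp, hq⟩ := h
  refine IsIso.inv_eq_of_hom_inv_id ?_
  exact (sc_trans a hp hq hp).trans (sc_self _)

end UR

namespace UR
variable {n : ℕ}

/-! ### standard radii and positions -/

def rr (i : Fin n) : ℝ := 4 ^ (i : ℕ)
def LL (n : ℕ) : ℝ := 4 ^ (n + 1)

lemma rr_pos (i : Fin n) : 0 < rr i := by unfold rr; positivity

lemma rr_lt {i j : Fin n} (h : i < j) : 4 * rr i ≤ rr j := by
  unfold rr
  rw [← pow_succ']
  exact pow_le_pow_right₀ (by norm_num) h

lemma rr_mono : StrictMono (rr : Fin n → ℝ) := fun i j h => by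
  have := rr_lt h; have := rr_pos i; linarith

lemma rr_LL (i j : Fin n) : 3 * (rr i + rr j) < LL n := by
  have h : ∀ i : Fin n, 4 * rr i ≤ 4 ^ n := fun i => by
    unfold rr
    rw [← pow_succ']
    exact pow_le_pow_right₀ (by norm_num) i.2
  have h1 := h i; have h2 := h j
  have h3 : (0 : ℝ) < 4 ^ n := by positivity
  unfold LL; rw [pow_succ]; linarith

lemma LL_pos : 0 < LL n := by unfold LL; positivity

def zU (u : ℂ) (c : Fin n → ℤ) (m : Fin n) : ℂ := (LL n * c m : ℝ) • u

lemma dot_self {u : ℂ} (hu : ‖u‖ = 1) : dot u u = 1 := by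
  have h2 : ‖u‖ * ‖u‖ = u.re * u.re + u.im * u.im := by
    rw [Complex.norm_mul_self_eq_normSq, Complex.normSq_apply]
  rw [dot, ← h2, hu, one_mul]

lemma dot_zU {u : ℂ} (hu : ‖u‖ = 1) (c : Fin n → ℤ) (m : Fin n) : dot u (zU u c m) = LL n * c m := by
  have h := dot_self hu
  rw [dot] at h
  rw [zU, dot, Complex.smul_re, Complex.smul_im, smul_eq_mul, smul_eq_mul]
  linear_combination (LL n * c m) * h

lemma dot_sub (u z w : ℂ) : dot u (z - w) = dot u z - dot u w := by
  simp [dot]; ring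

lemma dot_neg (u z : ℂ) : dot (-u) z = - dot u z := by
  simp [dot]; ring

def vCell (u : ℂ) (c : Fin n → ℤ) (i j : Fin n) : Cond :=
  if c j < c i then .out u else .out (-u)

lemma vHolds {u : ℂ} (hu : ‖u‖ = 1) {c : Fin n → ℤ} {i j : Fin n} (hc : c i ≠ c j)
    {z : Fin n → ℂ} (hzi : dot u (z i) = LL n * c i) (hzj : dot u (z j) = LL n * c j) (xi xj : ℝ) :
    (vCell u c i j).Holds xi xj (z i) (z j) (rr i) (rr j) := by
  have hL := rr_LL i j
  have h0 := rr_pos i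
  have h1 := rr_pos j
  unfold vCell
  split_ifs with h
  · refine ⟨hu, ?_⟩
    rw [dot_sub, hzi, hzj]
    have : (c j : ℝ) + 1 ≤ c i := by exact_mod_cast h
    have := mul_le_mul_of_nonneg_left this (LL_pos (n := n)).le
    linarith
  · refine ⟨by rwa [norm_neg], ?_⟩
    rw [dot_neg, dot_sub, hzi, hzj]
    have : (c i : ℝ) + 1 ≤ c j := by
      have : c i < c j := lt_of_le_of_ne (not_lt.1 h) hc
      exact_mod_cast this
    have := mul_le_mul_of_nonneg_left this (LL_pos (n := n)).le
    linarith

lemma mem_vCell {u : ℂ} (hu : ‖u‖ = 1) {c : Fin n → ℤ} (hc : Function.Injective c)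
    {z : Fin n → ℂ} (hz : ∀ m, dot u (z m) = LL n * c m) (x : Fin n → ℝ) :
    ((x, z, rr) : Cfg n) ∈ Cell (vCell u c) :=
  ⟨rr_pos, rr_mono, fun _ _ hij => vHolds hu (hc.ne hij.ne) (hz _) (hz _) _ _⟩

def SameOrder (x y : Fin n → ℝ) : Prop := ∀ i j, x i < x j ↔ y i < y j

def ordCell (x : Fin n → ℝ) (i j : Fin n) : Cond := if x i < x j then .lt else .gt

lemma ordHolds {x y : Fin n → ℝ} (hy : Function.Injective y) {i j : Fin n} (hij : i ≠ j)
    (h : x i < x j ↔ y i < y j) (zi zj : ℂ) (ri rj : ℝ) :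
    (ordCell x i j).Holds (y i) (y j) zi zj ri rj := by
  unfold ordCell
  split_ifs with h1
  · exact h.1 h1
  · exact lt_of_le_of_ne (not_lt.1 fun h2 => h1 (h.2 h2)) (hy.ne hij.symm)

lemma mem_ordCell {x : Fin n → ℝ} {p : Cfg n} (h0 : ∀ i, 0 < p.2.2 i) (h1 : StrictMono p.2.2)
    (hy : Function.Injective p.1) (h : SameOrder x p.1) : p ∈ Cell (ordCell x) :=
  ⟨h0, h1, fun _ _ hij => ordHolds hy hij.ne (h _ _) _ _ _ _⟩

/-- generic points -/
abbrev GX (n : ℕ) : Type := {p : XT n // Function.Injective p.1.1}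

abbrev GX.c (p : GX n) : Cfg n := p.1.1
abbrev GX.x (p : GX n) : Fin n → ℝ := p.1.1.1

def cid (i : Fin n) : ℤ := (i : ℕ)
lemma cid_inj : Function.Injective (cid : Fin n → ℤ) := fun i j h => by
  simp only [cid] at h; exact Fin.ext (by exact_mod_cast h)

/-- The base cell. -/
def bCell : Fin n → Fin n → Cond := vCell 1 cid

lemma mem_bCell (x : Fin n → ℝ) : ((x, zU 1 cid, rr) : Cfg n) ∈ Cell bCell :=
  mem_vCell (by simp) cid_inj (fun m => dot_zU (by simp) _ _) x

def vpt (x : Fin n → ℝ) : XT n := ⟨(x, zU 1 cid, rr), Cell_subset _ (mem_bCell x)⟩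

def xid (i : Fin n) : ℝ := (i : ℕ)
lemma xid_inj : Function.Injective (xid : Fin n → ℝ) := fun i j h => by
  simp only [xid] at h; exact Fin.ext (by exact_mod_cast h)

def x0 : XT n := vpt xid

lemma GX.mem_ord (p : GX n) : p.c ∈ Cell (ordCell p.x) :=
  mem_ordCell p.1.2.1 p.1.2.2.1 p.2 (fun _ _ => Iff.rfl)

lemma GX.vmem_ord (p : GX n) : (vpt p.x).1 ∈ Cell (ordCell p.x) :=
  mem_ordCell (p := (p.x, zU 1 cid, rr)) rr_pos rr_mono p.2 (fun _ _ => Iff.rfl)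

lemma GX.mem_ord' {p q : GX n} (h : SameOrder p.x q.x) : q.c ∈ Cell (ordCell p.x) :=
  mem_ordCell q.1.2.1 q.1.2.2.1 q.2 h

lemma GX.vmem_ord' {p q : GX n} (h : SameOrder p.x q.x) : (vpt q.x).1 ∈ Cell (ordCell p.x) :=
  mem_ordCell (p := (q.x, zU 1 cid, rr)) rr_pos rr_mono q.2 h

/-- canonical class from `x0` to generic point -/
def tau (p : GX n) : fg x0 ⟶ fg p.1 :=
  sc ⟨bCell, mem_bCell _, mem_bCell p.x⟩ ≫ sc (p := vpt p.x) ⟨ordCell p.x, p.vmem_ord, p.mem_ord⟩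

def psi (p q : GX n) (h : CoCell p.1 q.1) : fg (x0 (n := n)) ⟶ fg x0 :=
  tau p ≫ sc h ≫ inv (tau q)

lemma psi_trans (a) {p q r : GX n} (hp : p.c ∈ Cell a) (hq : q.c ∈ Cell a) (hr : r.c ∈ Cell a) :
    psi p q ⟨a, hp, hq⟩ ≫ psi q r ⟨a, hq, hr⟩ = psi p r ⟨a, hp, hr⟩ := by
  simp only [psi, Category.assoc, IsIso.inv_hom_id_assoc]
  rw [← sc_trans a hp hq hr, Category.assoc]

lemma psi_self {p : GX n} (h) : psi p p h = 𝟙 _ := by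
  simp [psi, sc_self]

lemma psi_eq_id_iff {p q : GX n} (h : CoCell p.1 q.1) :
    psi p q h = 𝟙 _ ↔ tau p ≫ sc h = tau q := by
  rw [psi, ← Category.assoc, IsIso.comp_inv_eq, Category.id_comp]

lemma psi_same {p q : GX n} (ho : SameOrder p.x q.x) (h) : psi p q h = 𝟙 _ := by
  rw [psi_eq_id_iff]
  have e1 : sc h = sc ⟨ordCell p.x, p.mem_ord, GX.mem_ord' ho⟩ := rfl
  have e2 : sc (p := vpt q.x) (q := q.1) ⟨ordCell q.x, q.vmem_ord, q.mem_ord⟩ =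
    sc ⟨ordCell p.x, GX.vmem_ord' ho, GX.mem_ord' ho⟩ := rfl
  rw [tau, tau, e1, e2, Category.assoc, sc_trans (p := vpt p.x) (ordCell p.x) p.vmem_ord p.mem_ord
      (GX.mem_ord' ho),
    ← sc_trans (p := x0) (q := vpt p.x) (r := vpt q.x) bCell (mem_bCell _) (mem_bCell _)
      (mem_bCell _),
    ← sc_trans (p := vpt p.x) (q := vpt q.x) (r := q.1) (ordCell p.x) p.vmem_ord
      (GX.vmem_ord' ho) (GX.mem_ord' ho), Category.assoc]

lemma psi_congr (a) {p q p' q' : GX n} (hp : p.c ∈ Cell a) (hq : q.c ∈ Cell a)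
    (hp' : p'.c ∈ Cell a) (hq' : q'.c ∈ Cell a) (h1 : SameOrder p.x p'.x) (h2 : SameOrder q'.x q.x) :
    psi p q ⟨a, hp, hq⟩ = psi p' q' ⟨a, hp', hq'⟩ := by
  rw [← psi_trans a hp hp' hq, ← psi_trans a hp' hq' hq, psi_same h1, psi_same h2]
  simp

lemma tau_of_base {p : GX n} (hp : p.c ∈ Cell bCell) : tau p = sc ⟨bCell, mem_bCell _, hp⟩ := by
  have e2 : sc (p := vpt p.x) (q := p.1) ⟨ordCell p.x, p.vmem_ord, p.mem_ord⟩ =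
    sc ⟨bCell, mem_bCell _, hp⟩ := rfl
  rw [tau, e2]
  exact sc_trans (p := x0) (q := vpt p.x) (r := p.1) bCell (mem_bCell _) (mem_bCell _) hp

lemma psi_base {p q : GX n} (hp : p.c ∈ Cell bCell) (hq : q.c ∈ Cell bCell) (h) :
    psi p q h = 𝟙 _ := by
  rw [psi_eq_id_iff, tau_of_base hp, tau_of_base hq]
  exact sc_trans (p := x0) (q := p.1) (r := q.1) bCell (mem_bCell _) hp hq

/-! ### straight configurations are trivial -/

def mkG (x : Fin n → ℝ) (hx : Function.Injective x) (z : Fin n → ℂ) (r : Fin n → ℝ)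
    (h : ((x, z, r) : Cfg n) ∈ XSet n) : GX n := ⟨⟨(x, z, r), h⟩, hx⟩

def Triv (u : ℂ) (c : Fin n → ℤ) : Prop :=
  ∀ (p q : GX n) (hp : p.c ∈ Cell (vCell u c)) (hq : q.c ∈ Cell (vCell u c)),
    psi p q ⟨_, hp, hq⟩ = 𝟙 _

lemma Triv.step {u u' : ℂ} {c c' : Fin n → ℤ} (h : Triv u c) (hu : ‖u‖ = 1) (hu' : ‖u'‖ = 1)
    (hd : u.re * u'.im - u.im * u'.re ≠ 0) (hc : Function.Injective c)
    (hc' : Function.Injective c') : Triv u' c' := by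
  intro p q hp hq
  obtain ⟨z, hz, hz'⟩ : ∃ z : Fin n → ℂ, (∀ m, dot u (z m) = LL n * c m) ∧
      ∀ m, dot u' (z m) = LL n * c' m := by
    refine ⟨fun m => ⟨(LL n * c m * u'.im - LL n * c' m * u.im) / (u.re * u'.im - u.im * u'.re),
      (u.re * (LL n * c' m) - u'.re * (LL n * c m)) / (u.re * u'.im - u.im * u'.re)⟩, ?_, ?_⟩
    · intro m; simp only [dot]
      rw [mul_div_assoc', mul_div_assoc', ← add_div, div_eq_iff hd]; ring
    · intro m; simp only [dot]
      rw [mul_div_assoc', mul_div_assoc', ← add_div, div_eq_iff hd]; ring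
  have m1 := fun x => mem_vCell hu hc hz x
  have m2 := fun x => mem_vCell hu' hc' hz' x
  let p' : GX n := mkG p.x p.2 z rr (Cell_subset _ (m1 _))
  let q' : GX n := mkG q.x q.2 z rr (Cell_subset _ (m1 _))
  rw [psi_congr (p' := p') (q' := q') _ hp hq (m2 _) (m2 _) (fun _ _ => Iff.rfl)
    (fun _ _ => Iff.rfl)]
  exact h p' q' (m1 _) (m1 _)

lemma triv_base : Triv (n := n) 1 cid := fun _ _ hp hq => psi_base hp hq _

lemma triv_all {u : ℂ} (hu : ‖u‖ = 1) {c : Fin n → ℤ} (hc : Function.Injective c) : Triv u c := by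
  have hI : Triv (n := n) Complex.I cid :=
    triv_base.step (by simp) (by simp) (by simp) cid_inj cid_inj
  by_cases h : u.im = 0
  · refine hI.step (by simp) hu ?_ cid_inj hc
    intro h'
    simp at h'
    have : u = 0 := Complex.ext h' h
    simp [this] at hu
  · exact triv_base.step (by simp) hu (by simpa using h) cid_inj hc

/-! ### crossings -/

/-- the orders of `x` and `y` agree except on the pair `i j` -/
def Cross (x y : Fin n → ℝ) (i j : Fin n) : Prop :=
  ∀ k l, ¬ (k = i ∧ l = j) → ¬ (k = j ∧ l = i) → (x k < x l ↔ y k < y l)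

def crossCell (x : Fin n → ℝ) (i j : Fin n) (c : Cond) (k l : Fin n) : Cond :=
  if k = i ∧ l = j then c else ordCell x k l

lemma mem_crossCell {x : Fin n → ℝ} {i j : Fin n} (hij : i < j) {c : Cond} {p : Cfg n}
    (h0 : ∀ i, 0 < p.2.2 i) (h1 : StrictMono p.2.2)
    (hy : Function.Injective p.1) (h : Cross x p.1 i j)
    (hc : c.Holds (p.1 i) (p.1 j) (p.2.1 i) (p.2.1 j) (p.2.2 i) (p.2.2 j)) :
    p ∈ Cell (crossCell x i j c) := by
  refine ⟨h0, h1, fun k l hkl => ?_⟩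
  unfold crossCell
  split_ifs with h
  · obtain ⟨rfl, rfl⟩ := h; exact hc
  · refine ordHolds hy hkl.ne (‹Cross x p.1 i j› k l h ?_) _ _ _ _
    rintro ⟨rfl, rfl⟩
    exact absurd hij (not_lt.2 hkl.le)

lemma Cross.refl (x : Fin n → ℝ) (i j) : Cross x x i j := fun _ _ _ _ => Iff.rfl

lemma psi_cross (c : Cond) {p q p' q' : GX n} {i j : Fin n} (hij : i < j)
    (hx : Cross p.x q.x i j) (h1 : p.x = p'.x) (h2 : q.x = q'.x)
    (hp : c.Holds (p.x i) (p.x j) (p.c.2.1 i) (p.c.2.1 j) (p.c.2.2 i) (p.c.2.2 j))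
    (hq : c.Holds (q.x i) (q.x j) (q.c.2.1 i) (q.c.2.1 j) (q.c.2.2 i) (q.c.2.2 j))
    (hp' : c.Holds (p'.x i) (p'.x j) (p'.c.2.1 i) (p'.c.2.1 j) (p'.c.2.2 i) (p'.c.2.2 j))
    (hq' : c.Holds (q'.x i) (q'.x j) (q'.c.2.1 i) (q'.c.2.1 j) (q'.c.2.2 i) (q'.c.2.2 j)) (h h') :
    psi p q h = psi p' q' h' := by
  refine psi_congr (crossCell p.x i j c) ?_ ?_ ?_ ?_ (by rw [h1]; exact fun _ _ => Iff.rfl)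
    (by rw [h2]; exact fun _ _ => Iff.rfl)
  · exact mem_crossCell hij p.1.2.1 p.1.2.2.1 p.2 (Cross.refl _ _ _) hp
  · exact mem_crossCell hij q.1.2.1 q.1.2.2.1 q.2 hx hq
  · refine mem_crossCell hij p'.1.2.1 p'.1.2.2.1 p'.2 ?_ hp'
    have : Cross p.x p'.x i j := by rw [h1]; exact Cross.refl _ _ _
    exact this
  · refine mem_crossCell hij q'.1.2.1 q'.1.2.2.1 q'.2 ?_ hq'
    have : Cross p.x q'.x i j := by rw [← h2]; exact hx
    exact this

lemma psi_cross_out_lt {p q : GX n} {i j : Fin n} (hij : i < j) (hx : Cross p.x q.x i j) {u : ℂ}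
    (hu : ‖u‖ = 1) (hp : p.c.2.2 i + p.c.2.2 j < dot u (p.c.2.1 i - p.c.2.1 j))
    (hq : q.c.2.2 i + q.c.2.2 j < dot u (q.c.2.1 i - q.c.2.1 j)) (h) : psi p q h = 𝟙 _ := by
  let c : Fin n → ℤ := fun m => - cid m
  have hc : Function.Injective c := fun a b h => cid_inj (neg_injective h)
  have m1 := fun x => mem_vCell hu hc (dot_zU hu c) x
  let p' : GX n := mkG p.x p.2 (zU u c) rr (Cell_subset _ (m1 _))
  let q' : GX n := mkG q.x q.2 (zU u c) rr (Cell_subset _ (m1 _))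
  have hv : vCell u c i j = .out u := by
    have : c j < c i := by simp only [c, cid]; simpa using hij
    simp [vCell, this]
  have ho : (Cond.out u).Holds (p'.x i) (p'.x j) (p'.c.2.1 i) (p'.c.2.1 j) (p'.c.2.2 i)
      (p'.c.2.2 j) := by
    have := (m1 p.x).2.2 i j hij
    rwa [hv] at this
  rw [psi_cross (.out u) (p' := p') (q' := q') hij hx rfl rfl ⟨hu, hp⟩ ⟨hu, hq⟩ ho ho h
    ⟨_, m1 _, m1 _⟩]
  exact triv_all hu hc p' q' (m1 _) (m1 _)

lemma Cross.symm_idx {x y : Fin n → ℝ} {i j : Fin n} (h : Cross x y i j) : Cross x y j i :=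
  fun k l h1 h2 => h k l h2 h1

lemma Cross.symm {x y : Fin n → ℝ} {i j : Fin n} (h : Cross x y i j) : Cross y x i j :=
  fun k l h1 h2 => (h k l h1 h2).symm

lemma psi_cross_out {p q : GX n} {i j : Fin n} (hij : i ≠ j) (hx : Cross p.x q.x i j) {u : ℂ}
    (hu : ‖u‖ = 1) (hp : p.c.2.2 i + p.c.2.2 j < dot u (p.c.2.1 i - p.c.2.1 j))
    (hq : q.c.2.2 i + q.c.2.2 j < dot u (q.c.2.1 i - q.c.2.1 j)) (h) : psi p q h = 𝟙 _ := by
  rcases hij.lt_or_gt with hlt | hlt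
  · exact psi_cross_out_lt hlt hx hu hp hq h
  · refine psi_cross_out_lt (u := -u) hlt hx.symm_idx (by rwa [norm_neg]) ?_ ?_ h
    · rw [dot_neg, dot_sub]; rw [dot_sub] at hp; linarith
    · rw [dot_neg, dot_sub]; rw [dot_sub] at hq; linarith

/-! ### inner crossings -/

/-- cluster positions for the pair `i < j` -/
def cc (i j m : Fin n) : ℤ := if m = i then 2 * cid j else 2 * cid m
def cc' (i j m : Fin n) : ℤ := if m = i then 2 * cid j + 1 else 2 * cid m

lemma cc'_inj (i j : Fin n) : Function.Injective (cc' i j) := by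
  intro a b h
  unfold cc' at h
  split_ifs at h with h1 h2 h3
  · rw [h1, h2]
  · omega
  · omega
  · exact cid_inj (by omega)

lemma cc_ne {i j : Fin n} {k l : Fin n} (hkl : k < l) (h : ¬ (k = i ∧ l = j)) (hij : i < j) :
    cc i j k ≠ cc i j l := by
  intro e
  have hcid : ∀ a b : Fin n, cid a = cid b → a = b := fun a b h => cid_inj h
  unfold cc at e
  split_ifs at e with h1 h2 h3
  · omega
  · have := hcid _ _ (show cid j = cid l by omega)
    exact h ⟨h1, this.symm⟩
  · have := hcid _ _ (show cid k = cid j by omega)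
    omega
  · have := hcid _ _ (show cid k = cid l by omega)
    omega

lemma cc_comp {i j : Fin n} {k l : Fin n} (hkl : k < l) (h : ¬ (k = i ∧ l = j)) (hij : i < j) :
    vCell 1 (cc i j) k l = vCell 1 (cc' i j) k l := by
  have hcid : ∀ a b : Fin n, cid a = cid b → a = b := fun a b h => cid_inj h
  have : cc i j l < cc i j k ↔ cc' i j l < cc' i j k := by
    have hne := cc_ne hkl h hij
    unfold cc cc'
    unfold cc at hne
    split_ifs with h1 h2 h3 <;> simp_all <;> omega
  unfold vCell
  simp only [this]

def dCell (i j : Fin n) (c : Cond) (k l : Fin n) : Cond :=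
  if k = i ∧ l = j then c else vCell 1 (cc i j) k l

lemma mem_dCell {i j : Fin n} (hij : i < j) {c : Cond} (x : Fin n → ℝ)
    (h : c.Holds (x i) (x j) (zU 1 (cc i j) i) (zU 1 (cc i j) j) (rr i) (rr j)) :
    ((x, zU 1 (cc i j), rr) : Cfg n) ∈ Cell (dCell i j c) := by
  refine ⟨rr_pos, rr_mono, fun k l hkl => ?_⟩
  unfold dCell
  split_ifs with h1
  · obtain ⟨rfl, rfl⟩ := h1; exact h
  · exact vHolds (by simp) (cc_ne hkl h1 hij) (dot_zU (by simp) _ _) (dot_zU (by simp) _ _) _ _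

lemma mem_dCell' {i j : Fin n} (hij : i < j) {c : Cond} (x : Fin n → ℝ)
    (h : c.Holds (x i) (x j) (zU 1 (cc' i j) i) (zU 1 (cc' i j) j) (rr i) (rr j)) :
    ((x, zU 1 (cc' i j), rr) : Cfg n) ∈ Cell (dCell i j c) := by
  refine ⟨rr_pos, rr_mono, fun k l hkl => ?_⟩
  unfold dCell
  split_ifs with h1
  · obtain ⟨rfl, rfl⟩ := h1; exact h
  · rw [cc_comp hkl h1 hij]
    exact vHolds (by simp) ((cc'_inj i j).ne hkl.ne) (dot_zU (by simp) _ _)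
      (dot_zU (by simp) _ _) _ _

lemma inn_cc {i j : Fin n} (hij : i < j) (xi xj : ℝ) :
    Cond.inn.Holds xi xj (zU 1 (cc i j) i) (zU 1 (cc i j) j) (rr i) (rr j) := by
  have h : zU 1 (cc i j) i = zU 1 (cc i j) j := by
    have : cc i j i = cc i j j := by simp [cc]
    simp only [zU, this]
  simp only [Cond.Holds, h, sub_self, norm_zero]
  exact sub_pos.2 (rr_mono hij)

lemma mem_inn {i j : Fin n} (hij : i < j) (x : Fin n → ℝ) :
    ((x, zU 1 (cc i j), rr) : Cfg n) ∈ Cell (dCell i j .inn) :=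
  mem_dCell hij x (inn_cc hij _ _)

/-- cluster points -/
def cpt {i j : Fin n} (hij : i < j) (x : Fin n → ℝ) (hx : Function.Injective x) : GX n :=
  mkG x hx (zU 1 (cc i j)) rr (Cell_subset _ (mem_inn hij x))

lemma psi_cpt_one {i j : Fin n} (hij : i < j) (c : Cond) (hc : c = .lt ∨ c = .gt)
    {x y : Fin n → ℝ} (hx : Function.Injective x) (hy : Function.Injective y)
    (h1 : c.Holds (x i) (x j) 0 0 0 0) (h2 : c.Holds (y i) (y j) 0 0 0 0) (h) :
    psi (cpt hij x hx) (cpt hij y hy) h = 𝟙 _ := by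
  have hH : ∀ {a b : ℝ} (z w : ℂ) (r s : ℝ), c.Holds a b 0 0 0 0 → c.Holds a b z w r s := by
    intro a b z w r s; rcases hc with rfl | rfl <;> exact id
  have m1 := fun x => mem_vCell (n := n) (u := 1) (by simp) (cc'_inj i j) (dot_zU (by simp) _) x
  let p' : GX n := mkG x hx (zU 1 (cc' i j)) rr (Cell_subset _ (m1 x))
  let q' : GX n := mkG y hy (zU 1 (cc' i j)) rr (Cell_subset _ (m1 y))
  have := psi_congr (dCell i j c) (p := cpt hij x hx) (q := cpt hij y hy) (p' := p') (q' := q')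
    (mem_dCell hij x (hH _ _ _ _ h1)) (mem_dCell hij y (hH _ _ _ _ h2))
    (mem_dCell' hij x (hH _ _ _ _ h1)) (mem_dCell' hij y (hH _ _ _ _ h2))
    (fun _ _ => Iff.rfl) (fun _ _ => Iff.rfl)
  refine this.trans ?_
  exact triv_all (by simp) (cc'_inj i j) p' q' (m1 _) (m1 _)

lemma nxid_inj : Function.Injective (fun i : Fin n => - xid i) :=
  fun _ _ h => xid_inj (neg_injective h)

lemma cpt_co {i j : Fin n} (hij : i < j) {x y : Fin n → ℝ} (hx : Function.Injective x)
    (hy : Function.Injective y) : CoCell (cpt hij x hx).1 (cpt hij y hy).1 :=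
  ⟨_, mem_inn hij x, mem_inn hij y⟩

/-- The generator loop. -/
def alpha (i j : Fin n) (hij : i < j) : fg (x0 (n := n)) ⟶ fg x0 :=
  psi (cpt hij xid xid_inj) (cpt hij _ nxid_inj) (cpt_co _ _ _)

lemma xid_lt {i j : Fin n} (hij : i < j) : xid i < xid j := by
  unfold xid; exact_mod_cast hij

lemma psi_cpt {i j : Fin n} (hij : i < j) {x y : Fin n → ℝ} (hx : Function.Injective x)
    (hy : Function.Injective y) (h1 : x i < x j) (h2 : y j < y i) (h) :
    psi (cpt hij x hx) (cpt hij y hy) h = alpha i j hij := by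
  have e := psi_trans (dCell i j .inn) (p := cpt hij x hx) (q := cpt hij xid xid_inj)
    (r := cpt hij y hy) (mem_inn hij _) (mem_inn hij _) (mem_inn hij _)
  have e2 := psi_trans (dCell i j .inn) (p := cpt hij xid xid_inj) (q := cpt hij _ nxid_inj)
    (r := cpt hij y hy) (mem_inn hij _) (mem_inn hij _) (mem_inn hij _)
  rw [psi_cpt_one hij .lt (Or.inl rfl) hx xid_inj h1 (xid_lt hij), Category.id_comp] at e
  rw [psi_cpt_one hij .gt (Or.inr rfl) nxid_inj hy (neg_lt_neg (xid_lt hij)) h2,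
    Category.comp_id] at e2
  exact e.symm.trans e2.symm

lemma psi_cross_in {p q : GX n} {i j : Fin n} (hij : i < j) (hx : Cross p.x q.x i j)
    (h1 : p.x i < p.x j) (h2 : q.x j < q.x i)
    (hp : ‖p.c.2.1 i - p.c.2.1 j‖ < p.c.2.2 j - p.c.2.2 i)
    (hq : ‖q.c.2.1 i - q.c.2.1 j‖ < q.c.2.2 j - q.c.2.2 i) (h) : psi p q h = alpha i j hij := by
  rw [psi_cross .inn (p' := cpt hij p.x p.2) (q' := cpt hij q.x q.2) hij hx rfl rfl hp hq
    (inn_cc hij _ _) (inn_cc hij _ _) h (cpt_co _ _ _)]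
  exact psi_cpt hij _ _ h1 h2 _

end UR

namespace UR
variable {n : ℕ}

/-! ### flat configurations and the relations -/

def Flat (y : Fin n → ℝ) : Prop :=
  ∀ i j, i < j → |y i - y j| < rr j - rr i ∨ rr i + rr j < |y i - y j|

def flatCell (y : Fin n → ℝ) (i j : Fin n) : Cond :=
  if |y i - y j| < rr j - rr i then .inn else if y j < y i then .out 1 else .out (-1)

def cz (y : Fin n → ℝ) (m : Fin n) : ℂ := (y m : ℂ)

lemma mem_flat {y : Fin n → ℝ} (hy : Flat y) (x : Fin n → ℝ) :
    ((x, cz y, rr) : Cfg n) ∈ Cell (flatCell y) := by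
  refine ⟨rr_pos, rr_mono, fun i j hij => ?_⟩
  unfold flatCell
  have h := hy i j hij
  split_ifs with h1 h2
  · simp only [Cond.Holds, cz]
    rw [← Complex.ofReal_sub, Complex.norm_real]; exact h1
  · refine ⟨by simp, ?_⟩
    have h := h.resolve_left h1
    rw [abs_of_pos (sub_pos.2 h2)] at h
    simpa [dot, cz] using h
  · refine ⟨by simp, ?_⟩
    have h := h.resolve_left h1
    rw [abs_of_nonpos (sub_nonpos.2 (not_lt.1 h2))] at h
    simp [dot, cz]; linarith

def fpt (y : Fin n → ℝ) (hy : Flat y) (x : Fin n → ℝ) (hx : Function.Injective x) : GX n :=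
  mkG x hx (cz y) rr (Cell_subset _ (mem_flat hy x))

def fpsi (y : Fin n → ℝ) (hy : Flat y) {x x' : Fin n → ℝ} (hx : Function.Injective x)
    (hx' : Function.Injective x') : fg (x0 (n := n)) ⟶ fg x0 :=
  psi (fpt y hy x hx) (fpt y hy x' hx') ⟨_, mem_flat hy x, mem_flat hy x'⟩

lemma fpsi_trans (y : Fin n → ℝ) (hy : Flat y) {x x' x'' : Fin n → ℝ} (hx : Function.Injective x)
    (hx' : Function.Injective x') (hx'' : Function.Injective x'') :
    fpsi y hy hx hx' ≫ fpsi y hy hx' hx'' = fpsi y hy hx hx'' :=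
  psi_trans (flatCell y) (mem_flat hy x) (mem_flat hy x') (mem_flat hy x'')

lemma fpsi_in {y : Fin n → ℝ} (hy : Flat y) {x x' : Fin n → ℝ} (hx : Function.Injective x)
    (hx' : Function.Injective x') {i j : Fin n} (hij : i < j) (hc : Cross x x' i j)
    (h1 : x i < x j) (h2 : x' j < x' i) (h : |y i - y j| < rr j - rr i) :
    fpsi y hy hx hx' = alpha i j hij := by
  have : ‖cz y i - cz y j‖ < rr j - rr i := by
    simp only [cz]
    rw [← Complex.ofReal_sub, Complex.norm_real]; exact h
  exact psi_cross_in hij hc h1 h2 this this _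

lemma fpsi_out {y : Fin n → ℝ} (hy : Flat y) {x x' : Fin n → ℝ} (hx : Function.Injective x)
    (hx' : Function.Injective x') {i j : Fin n} (hij : i ≠ j) (hc : Cross x x' i j)
    (h : rr i + rr j < |y i - y j|) : fpsi y hy hx hx' = 𝟙 _ := by
  rcases le_or_gt (y i) (y j) with h2 | h2
  · have : rr i + rr j < dot (-1) (cz y i - cz y j) := by
      rw [abs_of_nonpos (by linarith)] at h
      simp [dot, cz]; linarith
    exact psi_cross_out hij hc (by simp) this this _
  · have : rr i + rr j < dot 1 (cz y i - cz y j) := by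
      rw [abs_of_pos (by linarith)] at h
      simp [dot, cz]; linarith
    exact psi_cross_out hij hc (by simp) this this _

lemma cross_of {x y : Fin n → ℝ} {i j : Fin n} (lo hi : ℝ)
    (h : ∀ m, m ≠ i → m ≠ j → x m = y m ∧ (x m < lo ∨ hi < x m))
    (hi1 : lo ≤ x i) (hi2 : x i ≤ hi) (hj1 : lo ≤ x j) (hj2 : x j ≤ hi)
    (hi1' : lo ≤ y i) (hi2' : y i ≤ hi) (hj1' : lo ≤ y j) (hj2' : y j ≤ hi) : Cross x y i j := by
  have key : ∀ m, (m = i ∨ m = j) ∨ (x m = y m ∧ (x m < lo ∨ hi < x m)) := by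
    intro m
    by_cases h1 : m = i
    · exact Or.inl (Or.inl h1)
    by_cases h2 : m = j
    · exact Or.inl (Or.inr h2)
    exact Or.inr (h m h1 h2)
  intro k l h1 h2
  rcases key k with (rfl | rfl) | ⟨e, hk⟩ <;> rcases key l with (rfl | rfl) | ⟨e', hl⟩
  · simp
  · simp at h1
  · rw [← e']; rcases hl with hl | hl <;> constructor <;> intro <;> linarith
  · simp at h2
  · simp
  · rw [← e']; rcases hl with hl | hl <;> constructor <;> intro <;> linarith
  · rw [← e]; rcases hk with hl | hl <;> constructor <;> intro <;> linarith
  · rw [← e]; rcases hk with hl | hl <;> constructor <;> intro <;> linarith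
  · rw [e, e']

/-- explicit `x`-coordinates -/
def X4 (i j k l m : Fin n) : ℝ :=
  if m = i then 0 else if m = j then 1 else if m = k then 2 else if m = l then 3 else 10 + xid m

lemma xid_nonneg (m : Fin n) : 0 ≤ xid m := by unfold xid; positivity

lemma X4_inj (i j k l : Fin n) : Function.Injective (X4 i j k l) := by
  intro a b h
  have := xid_nonneg a
  have := xid_nonneg b
  unfold X4 at h
  split_ifs at h <;> first | (subst_vars; rfl) | (exfalso; linarith) | (exact xid_inj (by linarith))

lemma flat_of {c : Fin n → ℤ} {e : Fin n → ℝ} (he : ∀ m, |e m| ≤ 2)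
    (h : ∀ i j, i < j → c i = c j → |e i * rr i - e j * rr j| < rr j - rr i ∨
      rr i + rr j < |e i * rr i - e j * rr j|) : Flat fun m => LL n * c m + e m * rr m := by
  intro i j hij
  by_cases hc : c i = c j
  · have := h i j hij hc
    simp only [hc]
    rwa [add_sub_add_left_eq_sub]
  · right
    have hL := rr_LL i j
    have a1 := abs_le.1 (he i)
    have a2 := abs_le.1 (he j)
    have p1 := rr_pos i
    have p2 := rr_pos j
    have b1 := mul_le_mul_of_nonneg_right a1.1 p1.le
    have b2 := mul_le_mul_of_nonneg_right a1.2 p1.le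
    have b3 := mul_le_mul_of_nonneg_right a2.1 p2.le
    have b4 := mul_le_mul_of_nonneg_right a2.2 p2.le
    rw [lt_abs]
    rcases lt_or_gt_of_ne hc with h | h
    · right
      have : (c i : ℝ) + 1 ≤ c j := by exact_mod_cast h
      have := mul_le_mul_of_nonneg_left this (LL_pos (n := n)).le
      linarith
    · left
      have : (c j : ℝ) + 1 ≤ c i := by exact_mod_cast h
      have := mul_le_mul_of_nonneg_left this (LL_pos (n := n)).le
      linarith

lemma cross_01 {i j k l : Fin n} (hij : i ≠ j) : Cross (X4 i j k l) (X4 j i k l) i j := by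
  refine cross_of 0 1 (fun m h1 h2 => ⟨by simp [X4, h1, h2], ?_⟩) ?_ ?_ ?_ ?_ ?_ ?_ ?_ ?_
  · have := xid_nonneg m
    right; simp only [X4, h1, h2, if_false]; split_ifs <;> linarith
  all_goals simp [X4, hij, hij.symm]

lemma cross_12 {i j k l : Fin n} (hij : i ≠ j) (hik : i ≠ k) (hjk : j ≠ k) :
    Cross (X4 i j k l) (X4 i k j l) j k := by
  refine cross_of 1 2 (fun m h1 h2 => ⟨by simp [X4, h1, h2], ?_⟩) ?_ ?_ ?_ ?_ ?_ ?_ ?_ ?_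
  · have := xid_nonneg m
    simp only [X4, h1, h2, if_false]; split_ifs
    · left; linarith
    · right; linarith
    · right; linarith
  all_goals simp [X4, hij, hij.symm, hik, hik.symm, hjk, hjk.symm]

lemma cross_23 {i j k l : Fin n} (hik : i ≠ k) (hil : i ≠ l) (hjk : j ≠ k) (hjl : j ≠ l)
    (hkl : k ≠ l) : Cross (X4 i j k l) (X4 i j l k) k l := by
  refine cross_of 2 3 (fun m h1 h2 => ⟨by simp [X4, h1, h2], ?_⟩) ?_ ?_ ?_ ?_ ?_ ?_ ?_ ?_
  · have := xid_nonneg m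
    simp only [X4, h1, h2, if_false]; split_ifs
    · left; linarith
    · left; linarith
    · right; linarith
  all_goals simp [X4, hik, hik.symm, hil, hil.symm, hjk, hjk.symm, hjl, hjl.symm, hkl, hkl.symm]
  all_goals norm_num

lemma step01 {y : Fin n → ℝ} (hy : Flat y) {i j k l : Fin n} (hij : i < j)
    (h : |y i - y j| < rr j - rr i) :
    fpsi y hy (X4_inj i j k l) (X4_inj j i k l) = alpha i j hij :=
  fpsi_in hy _ _ hij (cross_01 hij.ne) (by simp [X4, hij.ne']) (by simp [X4, hij.ne]) h

lemma step01_out {y : Fin n → ℝ} (hy : Flat y) {i j k l : Fin n} (hij : i ≠ j)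
    (h : rr i + rr j < |y i - y j|) :
    fpsi y hy (X4_inj i j k l) (X4_inj j i k l) = 𝟙 _ :=
  fpsi_out hy _ _ hij (cross_01 hij) h

lemma step12 {y : Fin n → ℝ} (hy : Flat y) {i j k l : Fin n} (hij : i ≠ j) (hik : i ≠ k)
    (hjk : j < k) (h : |y j - y k| < rr k - rr j) :
    fpsi y hy (X4_inj i j k l) (X4_inj i k j l) = alpha j k hjk :=
  fpsi_in hy _ _ hjk (cross_12 hij hik hjk.ne)
    (by simp [X4, hij.symm, hik.symm, hjk.ne']) (by simp [X4, hij.symm, hik.symm, hjk.ne]) h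

lemma step23 {y : Fin n → ℝ} (hy : Flat y) {i j k l : Fin n} (hik : i ≠ k) (hil : i ≠ l)
    (hjk : j ≠ k) (hjl : j ≠ l) (hkl : k < l) (h : |y k - y l| < rr l - rr k) :
    fpsi y hy (X4_inj i j k l) (X4_inj i j l k) = alpha k l hkl :=
  fpsi_in hy _ _ hkl (cross_23 hik hil hjk hjl hkl.ne)
    (by simp [X4, hil.symm, hik.symm, hjk.symm, hjl.symm, hkl.ne']; norm_num)
    (by simp [X4, hil.symm, hik.symm, hjk.symm, hjl.symm, hkl.ne]; norm_num) h

/-- first relation -/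
lemma rel1 {i j k l : Fin n} (hij : i < j) (hkl : k < l) (hik : i ≠ k) (hil : i ≠ l) (hjk : j ≠ k)
    (hjl : j ≠ l) : alpha i j hij ≫ alpha k l hkl = alpha k l hkl ≫ alpha i j hij := by
  let c : Fin n → ℤ := fun m => if m = i then cid j else if m = k then cid l else cid m
  have hF : Flat fun m => LL n * (c m : ℝ) + (0 : Fin n → ℝ) m * rr m := by
    refine flat_of (by simp) (fun a b hab _ => Or.inl ?_)
    simpa using rr_mono hab
  have hcij : c i = c j := by simp only [c]; simp [hjk]
  have hckl : c k = c l := by simp only [c]; simp [hkl.ne', hik.symm, hil.symm]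
  have dij : |(LL n * (c i : ℝ) + (0 : Fin n → ℝ) i * rr i) -
      (LL n * (c j : ℝ) + (0 : Fin n → ℝ) j * rr j)| < rr j - rr i := by
    rw [hcij]; simpa using rr_mono hij
  have dkl : |(LL n * (c k : ℝ) + (0 : Fin n → ℝ) k * rr k) -
      (LL n * (c l : ℝ) + (0 : Fin n → ℝ) l * rr l)| < rr l - rr k := by
    rw [hckl]; simpa using rr_mono hkl
  have a1 := step01 hF (k := k) (l := l) hij dij
  have a2 := step23 hF hjk hjl hik hil hkl dkl
  have b1 := step23 hF hik hil hjk hjl hkl dkl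
  have b2 := step01 hF (k := l) (l := k) hij dij
  have e1 := fpsi_trans _ hF (X4_inj i j k l) (X4_inj j i k l) (X4_inj j i l k)
  have e2 := fpsi_trans _ hF (X4_inj i j k l) (X4_inj i j l k) (X4_inj j i l k)
  rw [a1, a2] at e1
  rw [b1, b2] at e2
  exact e1.trans e2.symm

/-- third relation -/
lemma rel3 {i j k : Fin n} (hij : i < j) (hik : i < k) (hjk : j < k) :
    alpha i j hij ≫ alpha i k hik ≫ alpha j k hjk =
      alpha j k hjk ≫ alpha i k hik ≫ alpha i j hij := by
  have hF : Flat fun m : Fin n => LL n * ((0 : ℤ) : ℝ) + (0 : Fin n → ℝ) m * rr m := by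
    refine flat_of (by simp) (fun a b hab _ => Or.inl ?_)
    simpa using rr_mono hab
  have d : ∀ {a b : Fin n}, a < b → |(LL n * ((0 : ℤ) : ℝ) + (0 : Fin n → ℝ) a * rr a) -
      (LL n * ((0 : ℤ) : ℝ) + (0 : Fin n → ℝ) b * rr b)| < rr b - rr a := by
    intro a b hab
    simpa using rr_mono hab
  have a1 := step01 hF (k := k) (l := k) hij (d hij)
  have a2 := step12 hF (l := k) hij.ne' hjk.ne hik (d hik)
  have a3 := step01 hF (k := i) (l := k) hjk (d hjk)
  have b1 := step12 hF (l := k) hij.ne hik.ne hjk (d hjk)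
  have b2 := step01 hF (k := j) (l := k) hik (d hik)
  have b3 := step12 hF (l := k) hik.ne' hjk.ne' hij (d hij)
  have e1 : fpsi _ hF (X4_inj i j k k) (X4_inj k j i k) =
      alpha i j hij ≫ alpha i k hik ≫ alpha j k hjk := by
    rw [← a1, ← a2, ← a3, fpsi_trans, fpsi_trans]
  have e2 : fpsi _ hF (X4_inj i j k k) (X4_inj k j i k) =
      alpha j k hjk ≫ alpha i k hik ≫ alpha i j hij := by
    rw [← b1, ← b2, ← b3, fpsi_trans, fpsi_trans]
  exact e1.symm.trans e2

/-- second relation -/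
lemma rel2 {i j k : Fin n} (hij : i ≠ j) (hik : i < k) (hjk : j < k) :
    alpha i k hik ≫ alpha j k hjk = alpha j k hjk ≫ alpha i k hik := by
  let c : Fin n → ℤ := fun m => if m = i then cid k else if m = j then cid k else cid m
  let e : Fin n → ℝ := fun m => if m = i then -2 else if m = j then 2 else 0
  have hck : c k = cid k := by simp only [c]; simp [hik.ne', hjk.ne']
  have hci : c i = cid k := by simp only [c]; simp
  have hcj : c j = cid k := by simp only [c]; simp
  have hek : e k = 0 := by simp only [e]; simp [hik.ne', hjk.ne']
  have hei : e i = -2 := by simp only [e]; simp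
  have hej : e j = 2 := by simp only [e]; simp [hij.symm]
  have p1 := rr_lt hik
  have p2 := rr_lt hjk
  have p3 := rr_pos i
  have p4 := rr_pos j
  have p5 := rr_pos k
  have dij : rr i + rr j < |e i * rr i - e j * rr j| := by
    rw [hei, hej, lt_abs]; right; linarith
  have dik : |e i * rr i - e k * rr k| < rr k - rr i := by
    rw [hei, hek, abs_lt]; constructor <;> linarith
  have djk : |e j * rr j - e k * rr k| < rr k - rr j := by
    rw [hej, hek, abs_lt]; constructor <;> linarith
  have hcase : ∀ m, m = i ∨ m = j ∨ m = k ∨ (m ≠ i ∧ m ≠ j ∧ m ≠ k) := by intro m; tauto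
  have hcm : ∀ m, m ≠ i → m ≠ j → c m = cid m := fun m h1 h2 => by simp only [c]; simp [h1, h2]
  have hF : Flat fun m => LL n * (c m : ℝ) + e m * rr m := by
    refine flat_of (fun m => by simp only [e]; split_ifs <;> simp) (fun a b hab h => ?_)
    have hcid : ∀ a b : Fin n, cid a = cid b → a = b := fun a b h => cid_inj h
    rcases hcase a with rfl | rfl | rfl | ⟨h1, h2, h3⟩ <;>
      rcases hcase b with rfl | rfl | rfl | ⟨h4, h5, h6⟩
    · exact absurd hab (lt_irrefl _)
    · exact Or.inr dij
    · exact Or.inl dik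
    · rw [hci, hcm b h4 h5] at h; exact absurd (hcid _ _ h).symm h6
    · right; rw [add_comm, abs_sub_comm]; exact dij
    · exact absurd hab (lt_irrefl _)
    · exact Or.inl djk
    · rw [hcj, hcm b h4 h5] at h; exact absurd (hcid _ _ h).symm h6
    · exact absurd hab hik.not_gt
    · exact absurd hab hjk.not_gt
    · exact absurd hab (lt_irrefl _)
    · rw [hck, hcm b h4 h5] at h; exact absurd (hcid _ _ h).symm h6
    · rw [hci, hcm a h1 h2] at h; exact absurd (hcid _ _ h) h3
    · rw [hcj, hcm a h1 h2] at h; exact absurd (hcid _ _ h) h3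
    · rw [hck, hcm a h1 h2] at h; exact absurd (hcid _ _ h) h3
    · rw [hcm a h1 h2, hcm b h4 h5] at h; exact absurd (hcid _ _ h) hab.ne
  have red : ∀ a b : Fin n, c a = c b → (LL n * (c a : ℝ) + e a * rr a) -
      (LL n * (c b : ℝ) + e b * rr b) = e a * rr a - e b * rr b := by
    intro a b h; rw [h]; ring
  have Dij := dij
  have Dik := dik
  have Djk := djk
  rw [← red i j (hci.trans hcj.symm)] at Dij
  rw [← red i k (hci.trans hck.symm)] at Dik
  rw [← red j k (hcj.trans hck.symm)] at Djk
  have Dji : rr j + rr i < |(LL n * (c j : ℝ) + e j * rr j) - (LL n * (c i : ℝ) + e i * rr i)| := by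
    rw [add_comm (rr j), abs_sub_comm]; exact Dij
  have a1 := step12 hF (l := k) hij hik.ne hjk Djk
  have a2 := step01 hF (k := j) (l := k) hik Dik
  have b1 := step01_out hF (k := k) (l := k) hij Dij
  have b2 := step12 hF (l := k) hij.symm hjk.ne hik Dik
  have b3 := step01 hF (k := i) (l := k) hjk Djk
  have b4 : fpsi _ hF (X4_inj k j i k) (X4_inj k i j k) = 𝟙 _ :=
    fpsi_out hF _ _ hij.symm (cross_12 hjk.ne' hik.ne' hij.symm) Dji
  have e1 : fpsi _ hF (X4_inj i j k k) (X4_inj k i j k) = alpha j k hjk ≫ alpha i k hik := by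
    rw [← a1, ← a2, fpsi_trans]
  have e2 : fpsi _ hF (X4_inj i j k k) (X4_inj k i j k) = alpha i k hik ≫ alpha j k hjk := by
    rw [← fpsi_trans _ hF (X4_inj i j k k) (X4_inj j i k k) (X4_inj k i j k),
      ← fpsi_trans _ hF (X4_inj j i k k) (X4_inj j k i k) (X4_inj k i j k),
      ← fpsi_trans _ hF (X4_inj j k i k) (X4_inj k j i k) (X4_inj k i j k), b1, b2, b3, b4]
    simp
  exact e2.symm.trans e1

/-! ### the homomorphism -/

def gmap (g : AltGen n) : FundamentalGroup (XT n) x0 := alpha g.1.1 g.1.2 g.2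

lemma fmul (a b : FundamentalGroup (XT n) x0) : a * b = (show fg (x0 (n := n)) ⟶ fg x0 from b) ≫
  (show fg (x0 (n := n)) ⟶ fg x0 from a) := rfl

lemma gmap_rels : ∀ r ∈ urltRels n, FreeGroup.lift gmap r = 1 := by
  intro r hr
  simp only [urltRels, Set.mem_union, Set.mem_iUnion, Set.mem_singleton_iff] at hr
  rcases hr with (⟨i, j, k, l, hij, hkl, h1, h2, h3, h4, rfl⟩ | ⟨i, j, k, hik, hjk, h, rfl⟩) |
    ⟨i, j, k, hij, hik, hjk, rfl⟩
  · rw [map_mul, map_inv, mul_inv_eq_one, map_mul, map_mul]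
    simp only [gβ, FreeGroup.lift_apply_of]
    exact (rel1 hij hkl h1 h2 h3 h4).symm
  · rw [map_mul, map_inv, mul_inv_eq_one, map_mul, map_mul]
    simp only [gβ, FreeGroup.lift_apply_of]
    exact (rel2 h hik hjk).symm
  · rw [map_mul, map_inv, mul_inv_eq_one, map_mul, map_mul, map_mul, map_mul]
    simp only [gβ, FreeGroup.lift_apply_of]
    exact (rel3 hij hik hjk).symm

/-- The comparison homomorphism. -/
def phi (n : ℕ) : PresentedGroup (urltRels n) →* FundamentalGroup (XT n) x0 :=
  PresentedGroup.toGroup gmap_rels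

/-- the generators of the presented group -/
def gg (i j : Fin n) (h : i < j) : PresentedGroup (urltRels n) := PresentedGroup.of ⟨(i, j), h⟩

lemma phi_gg (i j : Fin n) (h : i < j) : phi n (gg i j h) = alpha i j h :=
  PresentedGroup.toGroup.of _

end UR

namespace UR
variable {n : ℕ}

/-! ### surjectivity -/

abbrev HH (n : ℕ) : Subgroup (FundamentalGroup (XT n) x0) := (phi n).range

/-- membership in the range -/
def InH (f : fg (x0 (n := n)) ⟶ fg x0) : Prop := (show FundamentalGroup (XT n) x0 from f) ∈ HH n

lemma InH.one : InH (𝟙 (fg (x0 (n := n)))) := (HH n).one_mem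

lemma InH.comp {f g : fg (x0 (n := n)) ⟶ fg x0} (hf : InH f) (hg : InH g) : InH (f ≫ g) :=
  (HH n).mul_mem hg hf

lemma InH.of_mul {f g : fg (x0 (n := n)) ⟶ fg x0} (hf : InH f) (h : g ≫ f = 𝟙 _) : InH g := by
  have h2 : (show FundamentalGroup (XT n) x0 from f) * (show FundamentalGroup (XT n) x0 from g) = 1 :=
    h
  have h3 : (show FundamentalGroup (XT n) x0 from g) = (show FundamentalGroup (XT n) x0 from f)⁻¹ :=
    eq_inv_of_mul_eq_one_right h2
  unfold InH
  rw [h3]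
  exact (HH n).inv_mem hf

lemma InH.inv {f : fg (x0 (n := n)) ⟶ fg x0} (hf : InH f) : InH (CategoryTheory.inv f) :=
  hf.of_mul (by simp)

lemma InH.alpha (i j : Fin n) (h : i < j) : InH (alpha i j h) := ⟨gg i j h, phi_gg i j h⟩

lemma Cond.Holds.mix {c : Cond} {xi xj yi yj : ℝ} {zi zj wi wj : ℂ} {ri rj si sj : ℝ}
    (h1 : c.Holds xi xj zi zj ri rj) (h2 : c.Holds yi yj wi wj si sj) :
    c.Holds xi xj wi wj si sj := by
  rcases c with _ | _ | _ | u <;> first | exact h1 | exact h2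

lemma Cell.mix {a : Fin n → Fin n → Cond} {p q : Cfg n} (hp : p ∈ Cell a) (hq : q ∈ Cell a) :
    ((p.1, q.2.1, q.2.2) : Cfg n) ∈ Cell a :=
  ⟨hq.1, hq.2.1, fun i j h => (hp.2.2 i j h).mix (hq.2.2 i j h)⟩

def invs (x x' : Fin n → ℝ) : Finset (Fin n × Fin n) :=
  Finset.univ.filter fun p => x p.1 < x p.2 ∧ x' p.2 < x' p.1

lemma mem_invs {x x' : Fin n → ℝ} {p} : p ∈ invs x x' ↔ x p.1 < x p.2 ∧ x' p.2 < x' p.1 := by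
  simp [invs]

lemma swap_cross {x : Fin n → ℝ} {i j : Fin n} (hx : Function.Injective x) (hij : x i < x j)
    (h : ∀ m, ¬ (x i < x m ∧ x m < x j)) : Cross x (x ∘ Equiv.swap i j) i j := by
  refine cross_of (x i) (x j) (fun m h1 h2 => ⟨?_, ?_⟩) ?_ ?_ ?_ ?_ ?_ ?_ ?_ ?_
  · simp [Equiv.swap_apply_of_ne_of_ne h1 h2]
  · have := h m
    by_contra hc
    push Not at hc
    exact this ⟨lt_of_le_of_ne hc.1 (hx.ne h1.symm), lt_of_le_of_ne hc.2 (hx.ne h2)⟩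
  all_goals simp [hij.le]

lemma swap_mem {a : Fin n → Fin n → Cond} {x x' : Fin n → ℝ} {z : Fin n → ℂ} {r : Fin n → ℝ}
    (hx : ((x, z, r) : Cfg n) ∈ Cell a) (hx' : ((x', z, r) : Cfg n) ∈ Cell a) {i j : Fin n}
    (hinj : Function.Injective x)
    (hij : x i < x j) (hij' : x' j < x' i) (hc : Cross x (x ∘ Equiv.swap i j) i j) :
    ((x ∘ Equiv.swap i j, z, r) : Cfg n) ∈ Cell a := by
  refine ⟨hx.1, hx.2.1, fun k l hkl => ?_⟩
  have h1 := hx.2.2 k l hkl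
  have h2 := hx'.2.2 k l hkl
  have hinj' : (x ∘ Equiv.swap i j) k ≠ (x ∘ Equiv.swap i j) l :=
    (hinj.comp (Equiv.swap i j).injective).ne hkl.ne
  by_cases e1 : k = i ∧ l = j
  · obtain ⟨rfl, rfl⟩ := e1
    rcases ha : a k l with _ | _ | _ | u <;> rw [ha] at h1 h2 <;> simp only [Cond.Holds] at *
    · linarith
    · linarith
    · exact h1
    · exact h1
  by_cases e2 : k = j ∧ l = i
  · obtain ⟨rfl, rfl⟩ := e2
    rcases ha : a k l with _ | _ | _ | u <;> rw [ha] at h1 h2 <;> simp only [Cond.Holds] at *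
    · linarith
    · linarith
    · exact h1
    · exact h1
  have := hc k l e1 e2
  rcases ha : a k l with _ | _ | _ | u <;> rw [ha] at h1 <;> simp only [Cond.Holds] at *
  · exact this.1 h1
  · refine lt_of_le_of_ne (not_lt.1 fun h => ?_) hinj'.symm
    exact absurd (this.2 h) h1.not_gt
  · exact h1
  · exact h1

lemma psi_swap_mem {a : Fin n → Fin n → Cond} {p q : GX n} {i j : Fin n}
    (hp : p.c ∈ Cell a) (hq : q.c ∈ Cell a)
    (h1 : p.x i < p.x j) (h2 : q.x j < q.x i) (hc : Cross p.x q.x i j) :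
    InH (psi p q ⟨a, hp, hq⟩) := by
  have hne : i ≠ j := by rintro rfl; exact lt_irrefl _ h1
  rcases hne.lt_or_gt with h | h
  · have k1 := hp.2.2 i j h
    have k2 := hq.2.2 i j h
    rcases ha : a i j with _ | _ | _ | u <;> rw [ha] at k1 k2 <;> simp only [Cond.Holds] at k1 k2
    · exact absurd k2 h2.not_gt
    · exact absurd k1 h1.not_gt
    · rw [psi_cross_in h hc h1 h2 k1 k2]; exact InH.alpha _ _ _
    · rw [psi_cross_out hne hc k1.1 k1.2 k2.2]; exact InH.one
  · have k1 := hp.2.2 j i h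
    have k2 := hq.2.2 j i h
    rcases ha : a j i with _ | _ | _ | u <;> rw [ha] at k1 k2 <;> simp only [Cond.Holds] at k1 k2
    · exact absurd k1 h1.not_gt
    · exact absurd k2 h2.not_gt
    · have := psi_cross_in h hc.symm.symm_idx h2 h1 k2 k1 ⟨a, hq, hp⟩
      have e := psi_trans a hp hq hp
      rw [psi_self, this] at e
      exact (InH.alpha _ _ _).of_mul e
    · rw [psi_cross_out hne.symm hc.symm_idx k1.1 k1.2 k2.2]; exact InH.one

lemma psi_mem_aux {a : Fin n → Fin n → Cond} {x' : Fin n → ℝ} {z : Fin n → ℂ} {r : Fin n → ℝ}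
    (hi' : Function.Injective x') (hx' : ((x', z, r) : Cfg n) ∈ Cell a) (N : ℕ) :
    ∀ (x : Fin n → ℝ) (hi : Function.Injective x) (hx : ((x, z, r) : Cfg n) ∈ Cell a),
      (invs x x').card = N →
      InH (psi (mkG x hi z r (Cell_subset _ hx)) (mkG x' hi' z r (Cell_subset _ hx'))
        ⟨a, hx, hx'⟩) := by
  induction N using Nat.strong_induction_on with
  | _ N ih =>
  intro x hi hx hN
  rcases (invs x x').eq_empty_or_nonempty with h | h
  · have key : ∀ i j, x i < x j → x' i < x' j := by
      intro i j hij
      have : (i, j) ∉ invs x x' := by rw [h]; simp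
      rw [mem_invs] at this
      refine lt_of_le_of_ne (not_lt.1 fun hh => this ⟨hij, hh⟩) (hi'.ne ?_)
      rintro rfl; exact lt_irrefl _ hij
    rw [psi_same]
    · exact InH.one
    · intro i j
      refine ⟨key i j, fun hh => ?_⟩
      by_contra hc
      rcases (not_lt.1 hc).eq_or_lt with e | e
      · rw [hi e] at hh; exact lt_irrefl _ hh
      · exact lt_asymm hh (key _ _ e)
  · obtain ⟨⟨i, j⟩, hmem, hmin⟩ := Finset.exists_min_image _ (fun p => x p.2 - x p.1) h
    rw [mem_invs] at hmem
    simp only at hmem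
    have hadj : ∀ m, ¬ (x i < x m ∧ x m < x j) := by
      rintro m ⟨h1, h2⟩
      rcases lt_or_ge (x' m) (x' i) with h3 | h3
      · have := hmin (i, m) (mem_invs.2 ⟨h1, h3⟩)
        simp only at this; linarith
      · have := hmin (m, j) (mem_invs.2 ⟨h2, lt_of_lt_of_le hmem.2 h3⟩)
        simp only at this; linarith
    have hc := swap_cross hi hmem.1 hadj
    have hy := swap_mem hx hx' hi hmem.1 hmem.2 hc
    have hyi : Function.Injective (x ∘ Equiv.swap i j) := hi.comp (Equiv.swap i j).injective
    have hlt : (invs (x ∘ Equiv.swap i j) x').card < N := by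
      rw [← hN]
      apply Finset.card_lt_card
      refine ⟨fun p hp => ?_, fun hs => ?_⟩
      · obtain ⟨k, l⟩ := p
        rw [mem_invs] at hp ⊢
        refine ⟨(hc k l ?_ ?_).2 hp.1, hp.2⟩
        · rintro ⟨rfl, rfl⟩
          simp at hp
          exact lt_asymm hp.1 hmem.1
        · rintro ⟨rfl, rfl⟩
          exact lt_asymm hp.2 hmem.2
      · have := hs (mem_invs (p := (i, j)) |>.2 hmem)
        rw [mem_invs] at this
        simp at this
        exact lt_asymm this.1 hmem.1
    have e := psi_trans a (p := mkG x hi z r (Cell_subset _ hx))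
      (q := mkG _ hyi z r (Cell_subset _ hy)) (r := mkG x' hi' z r (Cell_subset _ hx')) hx hy hx'
    rw [← e]
    refine InH.comp (psi_swap_mem hx hy hmem.1 ?_ hc) (ih _ hlt _ hyi hy rfl)
    change (x ∘ Equiv.swap i j) j < (x ∘ Equiv.swap i j) i
    simpa using hmem.1

lemma psi_mem {a : Fin n → Fin n → Cond} {p q : GX n} (hp : p.c ∈ Cell a) (hq : q.c ∈ Cell a) :
    InH (psi p q ⟨a, hp, hq⟩) := by
  have hm := Cell.mix hp hq
  rw [← psi_trans a (q := mkG p.x p.2 q.c.2.1 q.c.2.2 (Cell_subset _ hm)) hp hm hq,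
    psi_same (p := p) (q := mkG p.x p.2 q.c.2.1 q.c.2.2 (Cell_subset _ hm)) (fun _ _ => Iff.rfl),
    Category.id_comp]
  exact psi_mem_aux q.2 hq _ p.x p.2 hm rfl

lemma exists_generic {U : Set (Cfg n)} (hU : IsOpen U) {p : Cfg n} (hp : p ∈ U) :
    ∃ q ∈ U, Function.Injective q.1 := by
  have h1 : ∀ᶠ t in nhdsWithin (0 : ℝ) {0}ᶜ, ((fun m => p.1 m + t * xid m, p.2) : Cfg n) ∈ U := by
    have : Continuous fun t : ℝ => ((fun m => p.1 m + t * xid m, p.2) : Cfg n) := by fun_prop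
    refine (this.tendsto 0).mono_left nhdsWithin_le_nhds |>.eventually (hU.mem_nhds ?_)
    simpa using hp
  have h2 : ∀ᶠ t in nhdsWithin (0 : ℝ) {0}ᶜ, ∀ i j, i ≠ j →
      p.1 i + t * xid i ≠ p.1 j + t * xid j := by
    rw [Filter.eventually_all]; intro i
    rw [Filter.eventually_all]; intro j
    by_cases hij : i = j
    · simp [hij]
    by_cases hp : p.1 i = p.1 j
    · filter_upwards [self_mem_nhdsWithin] with t ht _ h
      rw [hp] at h
      have h3 : t * xid i = t * xid j := by linarith
      exact hij (xid_inj (mul_left_cancel₀ ht h3))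
    · have : Continuous fun t : ℝ => (p.1 i + t * xid i) - (p.1 j + t * xid j) := by fun_prop
      have h0 : ∀ᶠ t in nhds (0 : ℝ), (p.1 i + t * xid i) - (p.1 j + t * xid j) ≠ 0 := by
        apply this.continuousAt.eventually_ne
        simpa [sub_eq_zero] using hp
      filter_upwards [nhdsWithin_le_nhds h0] with t ht _ h
      exact ht (sub_eq_zero.2 h)
  obtain ⟨t, ht1, ht2⟩ := (h1.and h2).exists
  exact ⟨_, ht1, fun i j h => by_contra fun hij => ht2 i j hij h⟩

lemma exists_gx {a b : Fin n → Fin n → Cond} {p : Cfg n} (h : p ∈ Cell a) (h' : p ∈ Cell b) :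
    ∃ g : GX n, g.c ∈ Cell a ∧ g.c ∈ Cell b := by
  obtain ⟨q, hq, hi⟩ := exists_generic ((Cell_open a).inter (Cell_open b)) ⟨h, h'⟩
  exact ⟨⟨⟨q, Cell_subset _ hq.1⟩, hi⟩, hq.1, hq.2⟩

lemma exists_kap (p : XT n) : ∃ g : GX n, CoCell g.1 p := by
  obtain ⟨a, ha⟩ := exists_cell p.2
  obtain ⟨g, hg, -⟩ := exists_gx ha ha
  exact ⟨g, a, hg, ha⟩

def kg (p : XT n) : GX n := (exists_kap p).choose
lemma kg_spec (p : XT n) : CoCell (kg p).1 p := (exists_kap p).choose_spec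

def kap (p : XT n) : fg x0 ⟶ fg p := tau (kg p) ≫ sc (kg_spec p)

lemma kap_factor {a : Fin n → Fin n → Cond} {p : XT n} (hp : p.1 ∈ Cell a) :
    ∃ (g : GX n) (hg : g.c ∈ Cell a) (h : fg (x0 (n := n)) ⟶ fg x0), InH h ∧
      kap p = h ≫ tau g ≫ sc ⟨a, hg, hp⟩ := by
  obtain ⟨b, hb1, hb2⟩ := kg_spec p
  obtain ⟨g, hg1, hg2⟩ := exists_gx hp hb2
  refine ⟨g, hg1, psi (kg p) g ⟨b, hb1, hg2⟩, psi_mem hb1 hg2, ?_⟩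
  have e : sc ⟨a, hg1, hp⟩ = sc ⟨b, hg2, hb2⟩ := rfl
  have e2 : sc (kg_spec p) = sc ⟨b, hb1, hb2⟩ := rfl
  rw [kap, psi, e, e2, ← sc_trans b hb1 hg2 hb2]
  simp

def Good {p q : XT n} (f : fg p ⟶ fg q) : Prop := InH (kap p ≫ f ≫ inv (kap q))

lemma Good.comp {p q r : XT n} {f : fg p ⟶ fg q} {g : fg q ⟶ fg r} (hf : Good f) (hg : Good g) :
    Good (f ≫ g) := by
  have := InH.comp hf hg
  simpa [Good] using this

lemma good_sc {p q : XT n} (h : CoCell p q) : Good (sc h) := by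
  obtain ⟨a, hp, hq⟩ := h
  obtain ⟨g, hg, h, hh, e⟩ := kap_factor hp
  obtain ⟨g', hg', h', hh', e'⟩ := kap_factor hq
  have h1 := (hh.comp (psi_mem hg hg')).comp hh'.inv
  unfold Good
  convert h1 using 1
  simp only [e, e', psi]
  rw [← sc_trans a hg hp hg', ← sc_trans a hp hq hg', ← sc_inv ⟨a, hg', hq⟩]
  simp

lemma good_path {p q : XT n} (γ : Path p q) : Good (Path.Homotopic.Quotient.mk γ : fg p ⟶ fg q) := by
  have hcast : ∀ {p' q' : XT n} (h : p' = p) (h' : q' = q),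
      Good (Path.Homotopic.Quotient.mk (γ.cast h h') : fg p' ⟶ fg q') →
      Good (Path.Homotopic.Quotient.mk γ : fg p ⟶ fg q) := by
    rintro p' q' rfl rfl h; exact h
  obtain ⟨t, ht0, hmono, ⟨m, hm⟩, hcov⟩ := exists_monotone_Icc_subset_open_cover_unitInterval
    (ι := Fin n → Fin n → Cond) (c := fun a => γ ⁻¹' (Subtype.val ⁻¹' Cell a))
    (fun a => ((Cell_open a).preimage continuous_subtype_val).preimage γ.continuous)
    (fun s _ => by
      obtain ⟨a, ha⟩ := exists_cell (γ s).2
      exact Set.mem_iUnion.2 ⟨a, ha⟩)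
  have key : ∀ k s, t k = s → Good (Path.Homotopic.Quotient.mk (γ.subpath 0 s) :
      fg (γ 0) ⟶ fg (γ s)) := by
    intro k
    induction k with
    | zero =>
      rintro s rfl
      rw [ht0, Path.subpath_self]
      obtain ⟨a, ha⟩ := exists_cell (γ 0).2
      rw [mk_eq_sc a ha ha _ (fun _ => ha)]
      exact good_sc _
    | succ k ih =>
      rintro s rfl
      obtain ⟨a, ha⟩ := hcov k
      have hle := hmono (Nat.le_succ k)
      have : Good (Path.Homotopic.Quotient.mk (γ.subpath (t k) (t (k+1))) :
          fg (γ (t k)) ⟶ fg (γ (t (k+1)))) := by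
        rw [mk_eq_sc a (ha ⟨le_rfl, hle⟩) (ha ⟨hle, le_rfl⟩)]
        · exact good_sc _
        · intro s
          have hs : γ.subpath (t k) (t (k+1)) s ∈ γ '' (Set.Icc (t k) (t (k+1))) := by
            rw [← Path.range_subpath_of_le _ _ _ hle]; exact Set.mem_range_self s
          obtain ⟨u, hu, hu'⟩ := hs
          rw [← hu']
          exact ha hu
      have h2 := (ih _ rfl).comp this
      have e : Path.Homotopic.Quotient.mk ((γ.subpath 0 (t k)).trans (γ.subpath (t k) (t (k+1)))) =
          Path.Homotopic.Quotient.mk (γ.subpath 0 (t (k+1))) :=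
        Path.Homotopic.Quotient.eq.2 ⟨Path.Homotopy.subpathTransSubpath γ 0 (t k) (t (k+1))⟩
      rw [← e]
      exact h2
  have h1 := key m 1 (hm m le_rfl)
  rw [Path.subpath_zero_one] at h1
  exact hcast _ _ h1

lemma phi_surjective : Function.Surjective (phi n) := by
  intro f
  obtain ⟨γ, hγ⟩ := Path.Homotopic.Quotient.mk_surjective (show Path.Homotopic.Quotient x0 x0 from f)
  have h := good_path γ
  rw [hγ] at h
  let X0 : GX n := ⟨x0, xid_inj⟩
  have hb : X0.c ∈ Cell bCell := mem_bCell xid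
  have ht : tau X0 = 𝟙 _ := by rw [tau_of_base hb]; exact sc_self _
  have hk : InH (kap (x0 (n := n))) := by
    obtain ⟨b, hb1, hb2⟩ := kg_spec (x0 (n := n))
    have h1 := psi_mem (q := X0) hb1 hb2
    have h2 : psi (kg x0) X0 ⟨b, hb1, hb2⟩ = kap x0 := by
      have : inv (tau X0) = 𝟙 _ := by
        simp only [ht]; exact IsIso.inv_id
      rw [psi, this, Category.comp_id]; rfl
    rwa [h2] at h1
  have h3 := (hk.inv.comp h).comp hk
  simp only [Category.assoc, IsIso.inv_hom_id, Category.comp_id, IsIso.inv_hom_id_assoc] at h3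
  exact h3

lemma joined_x0 (p : XT n) : Joined x0 p := by
  obtain ⟨γ, -⟩ := Path.Homotopic.Quotient.mk_surjective
    (show Path.Homotopic.Quotient x0 p from kap p)
  exact ⟨γ⟩

end UR

namespace UR
variable {n : ℕ}

/-! ### algebra in the presented group -/

abbrev GP (n : ℕ) : Type := PresentedGroup (urltRels n)

def ga (i j : Fin n) : GP n := if h : i < j then gg i j h else 1

lemma ga_of {i j : Fin n} (h : i < j) : ga i j = gg i j h := dif_pos h

lemma rel_of {a b : FreeGroup (AltGen n)} (h : a * b⁻¹ ∈ urltRels n) :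
    (PresentedGroup.mk (urltRels n) a) = PresentedGroup.mk (urltRels n) b := by
  have h1 : PresentedGroup.mk (urltRels n) (a * b⁻¹) = 1 := PresentedGroup.one_of_mem h
  rwa [map_mul, map_inv, mul_inv_eq_one] at h1

lemma ga_comm2 (i j k : Fin n) : Commute (ga i k) (ga j k) := by
  by_cases hi : i < k
  swap
  · simp [ga, hi]
  by_cases hj : j < k
  swap
  · simp [ga, hj]
  by_cases hij : i = j
  · subst hij; exact Commute.refl _
  rw [ga_of hi, ga_of hj]
  have h : gβ i k hi * gβ j k hj * (gβ j k hj * gβ i k hi)⁻¹ ∈ urltRels n := by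
    refine Or.inl (Or.inr ?_)
    simp only [Set.mem_iUnion, Set.mem_singleton_iff]
    exact ⟨i, j, k, hi, hj, hij, rfl⟩
  have := rel_of h
  rw [map_mul, map_mul] at this
  exact this

lemma ga_comm1 {i j k l : Fin n} (h1 : i ≠ k) (h2 : i ≠ l) (h3 : j ≠ k) (h4 : j ≠ l) :
    Commute (ga i j) (ga k l) := by
  by_cases hi : i < j
  swap
  · simp [ga, hi]
  by_cases hj : k < l
  swap
  · simp [ga, hj]
  rw [ga_of hi, ga_of hj]
  have h : gβ i j hi * gβ k l hj * (gβ k l hj * gβ i j hi)⁻¹ ∈ urltRels n := by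
    refine Or.inl (Or.inl ?_)
    simp only [Set.mem_iUnion, Set.mem_singleton_iff]
    exact ⟨i, j, k, l, hi, hj, h1, h2, h3, h4, rfl⟩
  have := rel_of h
  rw [map_mul, map_mul] at this
  exact this

lemma ga_comm3 {i j k : Fin n} (hij : i < j) (hjk : j < k) :
    Commute (ga i j) (ga i k * ga j k) := by
  have hik := hij.trans hjk
  have h : gβ i j hij * gβ i k hik * gβ j k hjk * (gβ j k hjk * gβ i k hik * gβ i j hij)⁻¹
      ∈ urltRels n := by
    refine Or.inr ?_
    simp only [Set.mem_iUnion, Set.mem_singleton_iff]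
    exact ⟨i, j, k, hij, hik, hjk, rfl⟩
  have := rel_of h
  rw [map_mul, map_mul, map_mul, map_mul] at this
  have h2 := ga_comm2 i j k
  unfold Commute SemiconjBy
  rw [h2.eq, ← h2.eq, ga_of hij, ga_of hik, ga_of hjk, ← mul_assoc]
  rw [ga_of hik, ga_of hjk] at h2
  rw [h2.eq]
  exact this

def aa (k : Fin n) (S : Finset (Fin n)) : GP n :=
  S.noncommProd (fun i => ga i k) (fun i _ j _ _ => ga_comm2 i j k)

lemma aa_union (k : Fin n) {S T : Finset (Fin n)} (h : Disjoint S T) :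
    aa k (S ∪ T) = aa k S * aa k T :=
  Finset.noncommProd_union_of_disjoint h _ _

lemma aa_empty (k : Fin n) : aa k ∅ = 1 := Finset.noncommProd_empty _ _

lemma aa_pair (k : Fin n) {i j : Fin n} (h : i ≠ j) : aa k {i, j} = ga i k * ga j k := by
  have : ({i, j} : Finset (Fin n)) = {i} ∪ {j} := rfl
  rw [this, aa_union k (by simpa using h)]
  simp [aa]

lemma aa_comm (k : Fin n) {S : Finset (Fin n)} {g : GP n} (h : ∀ i ∈ S, Commute g (ga i k)) :
    Commute g (aa k S) :=
  Finset.noncommProd_commute _ _ _ _ h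

lemma ga_comm_aa {l j k : Fin n} (hlj : l < j) (hjk : j < k) {S : Finset (Fin n)}
    (hS : ∀ i ∈ S, i < k) (h : l ∈ S ↔ j ∈ S) : Commute (ga l j) (aa k S) := by
  have hgen : ∀ T : Finset (Fin n), (∀ i ∈ T, i < k ∧ i ≠ l ∧ i ≠ j) →
      Commute (ga l j) (aa k T) := by
    intro T hT
    refine aa_comm k fun i hi => ?_
    obtain ⟨h1, h2, h3⟩ := hT i hi
    exact ga_comm1 h2.symm (hlj.trans hjk).ne h3.symm hjk.ne
  by_cases hl : l ∈ S
  · have hj := h.1 hl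
    have e : S = (S \ {l, j}) ∪ {l, j} := by
      rw [Finset.sdiff_union_of_subset]
      intro a ha
      simp at ha
      rcases ha with rfl | rfl <;> assumption
    rw [e, aa_union k Finset.sdiff_disjoint, aa_pair k hlj.ne]
    refine Commute.mul_right (hgen _ fun i hi => ?_) (ga_comm3 hlj hjk)
    simp at hi
    exact ⟨hS i hi.1, by tauto, by tauto⟩
  · refine hgen _ fun i hi => ⟨hS i hi, ?_, ?_⟩
    · rintro rfl; exact hl hi
    · rintro rfl; exact hl (h.2 hi)

lemma list_prod_mul {M : Type*} [Monoid M] {ι : Type*} (f g : ι → M) (l : List ι)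
    (h : l.Pairwise fun a b => Commute (f a) (g b)) :
    (l.map fun a => g a * f a).prod = (l.map g).prod * (l.map f).prod := by
  induction l with
  | nil => simp
  | cons a l ih =>
    rw [List.pairwise_cons] at h
    simp only [List.map_cons, List.prod_cons]
    rw [ih h.2]
    have : Commute (f a) (l.map g).prod := by
      refine Commute.list_prod_right _ _ fun x hx => ?_
      obtain ⟨b, hb, rfl⟩ := List.mem_map.1 hx
      exact h.1 b hb
    calc g a * f a * ((l.map g).prod * (l.map f).prod)
        = g a * (f a * (l.map g).prod) * (l.map f).prod := by simp only [mul_assoc]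
      _ = _ := by rw [this.eq]; simp only [mul_assoc]

/-- nesting relations -/
structure Nest (n : ℕ) where
  F : Fin n → Fin n → Prop
  lt : ∀ {i j}, F i j → i < j
  tr : ∀ {i j k}, F i j → F j k → F i k
  ch : ∀ {i j k}, F i j → F i k → j < k → F j k

open Classical in
def SS (F : Fin n → Fin n → Prop) (x : Fin n → ℝ) (k : Fin n) : Finset (Fin n) :=
  Finset.univ.filter fun i => F i k ∧ x k < x i

lemma mem_SS {F : Fin n → Fin n → Prop} {x : Fin n → ℝ} {i k : Fin n} :
    i ∈ SS F x k ↔ F i k ∧ x k < x i := by simp [SS]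

def hh (F : Fin n → Fin n → Prop) (x : Fin n → ℝ) : GP n :=
  ((List.finRange n).reverse.map fun k => aa k (SS F x k)).prod

lemma hh_mul (F : Nest n) (F0 : Fin n → Fin n → Prop) (x x' : Fin n → ℝ)
    (hx : ∀ i j, x' i < x' j → x i < x j) (h0 : ∀ i j, F0 i j ↔ F.F i j ∧ x' i = x' j) :
    hh F.F x = hh F0 x * hh F.F x' := by
  unfold hh
  rw [← list_prod_mul]
  · congr 1
    refine List.map_congr_left fun k _ => ?_
    rw [← aa_union]
    · congr 1
      ext i
      simp only [Finset.mem_union, mem_SS, h0]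
      constructor
      · rintro ⟨h1, h2⟩
        rcases lt_trichotomy (x' i) (x' k) with h | h | h
        · exact absurd (hx _ _ h) h2.not_gt
        · exact Or.inl ⟨⟨h1, h⟩, h2⟩
        · exact Or.inr ⟨h1, h⟩
      · rintro (⟨⟨h1, h⟩, h2⟩ | ⟨h1, h2⟩)
        · exact ⟨h1, h2⟩
        · exact ⟨h1, hx _ _ h2⟩
    · rw [Finset.disjoint_left]
      intro i h1 h2
      rw [mem_SS, h0] at h1
      rw [mem_SS] at h2
      exact h2.2.ne h1.1.2.symm
  · rw [List.pairwise_reverse]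
    refine (List.pairwise_lt_finRange n).imp ?_
    intro j k hjk
    refine Commute.symm ?_
    have : ∀ l ∈ SS F0 x j, Commute (ga l j) (aa k (SS F.F x' k)) := by
      intro l hl
      rw [mem_SS, h0] at hl
      obtain ⟨⟨h1, h2⟩, -⟩ := hl
      refine ga_comm_aa (F.lt h1) hjk (fun i hi => F.lt (mem_SS.1 hi).1) ?_
      rw [mem_SS, mem_SS, h2]
      constructor
      · rintro ⟨h3, h4⟩; exact ⟨F.ch h1 h3 hjk, h4⟩
      · rintro ⟨h3, h4⟩; exact ⟨F.tr h1 h3, h4⟩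
    refine (aa_comm j fun l hl => (this l hl).symm).symm

lemma hh_empty (x : Fin n → ℝ) : hh (fun _ _ => False) x = 1 := by
  unfold hh
  refine List.prod_eq_one ?_
  intro g hg
  obtain ⟨k, -, rfl⟩ := List.mem_map.1 hg
  have : SS (fun _ _ => False) x k = ∅ := by ext i; simp [mem_SS]
  rw [this, aa_empty]

lemma hh_single {i j : Fin n} (hij : i < j) (x : Fin n → ℝ) :
    hh (fun a b => a = i ∧ b = j) x = if x j < x i then gg i j hij else 1 := by
  unfold hh
  have h1 : ∀ k, k ≠ j → aa k (SS (fun a b => a = i ∧ b = j) x k) = 1 := by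
    intro k hk
    have : SS (fun a b => a = i ∧ b = j) x k = ∅ := by ext i; simp [mem_SS, hk]
    rw [this, aa_empty]
  have h2 : aa j (SS (fun a b => a = i ∧ b = j) x j) = if x j < x i then gg i j hij else 1 := by
    split_ifs with h
    · have : SS (fun a b => a = i ∧ b = j) x j = {i} := by
        ext a; simp only [mem_SS, Finset.mem_singleton]
        constructor
        · exact fun h => h.1.1
        · rintro rfl; exact ⟨⟨rfl, trivial⟩, h⟩
      rw [this]; simp [aa, ga_of hij]
    · have : SS (fun a b => a = i ∧ b = j) x j = ∅ := by
        ext a; simp only [mem_SS, Finset.notMem_empty, iff_false]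
        rintro ⟨⟨rfl, -⟩, h'⟩; exact h h'
      rw [this, aa_empty]
  rw [← h2]
  have hnd : (List.finRange n).reverse.Nodup := List.nodup_reverse.2 (List.nodup_finRange n)
  have hmem : j ∈ (List.finRange n).reverse := by simp
  revert hnd hmem
  generalize (List.finRange n).reverse = l
  intro hnd hmem
  obtain ⟨s, t, rfl⟩ := List.append_of_mem hmem
  have hs : j ∉ s := fun h => by
    have := List.disjoint_of_nodup_append hnd; exact this h (by simp)
  have ht : j ∉ t := (List.nodup_cons.1 (List.nodup_append.1 hnd).2.1).1
  rw [List.map_append, List.prod_append, List.map_cons, List.prod_cons,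
    List.prod_eq_one (l := s.map _), List.prod_eq_one (l := t.map _), one_mul, mul_one]
  · intro g hg
    obtain ⟨k, hk, rfl⟩ := List.mem_map.1 hg
    exact h1 k (by rintro rfl; exact ht hk)
  · intro g hg
    obtain ⟨k, hk, rfl⟩ := List.mem_map.1 hg
    exact h1 k (by rintro rfl; exact hs hk)

end UR

namespace UR

/-! ### a covering space from a locally constant cocycle -/

/-- the bundle -/
def core {B G ι : Type} [TopologicalSpace B] [Group G] [TopologicalSpace G] [DiscreteTopology G] (U : ι → Set B)
    (hU : ∀ i, IsOpen (U i)) (idx : B → ι) (hidx : ∀ b, b ∈ U (idx b)) (h : ι → B → G)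
    (hloc : ∀ i j b, b ∈ U i → b ∈ U j → ∀ᶠ b' in nhds b,
      (h j b')⁻¹ * h i b' = (h j b)⁻¹ * h i b) : FiberBundleCore ι B G where
  baseSet := U
  isOpen_baseSet := hU
  indexAt := idx
  mem_baseSet_at := hidx
  coordChange i j b v := (h j b)⁻¹ * h i b * v
  coordChange_self i b hb v := by simp
  continuousOn_coordChange i j := by
    rintro ⟨b, v⟩ ⟨⟨hi, hj⟩, -⟩
    refine ContinuousAt.continuousWithinAt ?_
    have h1 : ∀ᶠ q : B × G in nhds (b, v), (h j q.1)⁻¹ * h i q.1 * q.2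
        = (h j b)⁻¹ * h i b * q.2 := by
      rw [nhds_prod_eq]
      filter_upwards [(hloc i j b hi hj).prod_inl (nhds v)] with q hq
      rw [hq]
    refine ContinuousAt.congr ?_ (Filter.EventuallyEq.symm h1)
    exact (continuous_of_discreteTopology (f := fun g : G => (h j b)⁻¹ * h i b * g)).continuousAt.comp
      continuous_snd.continuousAt
  coordChange_comp i j k b hb v := by group

lemma exists_mon {B G ι : Type} [TopologicalSpace B] [Group G] (U : ι → Set B)
    (hU : ∀ i, IsOpen (U i)) (idx : B → ι) (hidx : ∀ b, b ∈ U (idx b)) (h : ι → B → G)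
    (hloc : ∀ i j b, b ∈ U i → b ∈ U j → ∀ᶠ b' in nhds b,
      (h j b')⁻¹ * h i b' = (h j b)⁻¹ * h i b) : ∃ m : ∀ {p q : B}, Path.Homotopic.Quotient p q → G → G,
    (∀ {p q r : B} (γ : Path.Homotopic.Quotient p q) (γ' : Path.Homotopic.Quotient q r) (w : G),
      m (γ.trans γ') w = m γ' (m γ w)) ∧
    ∀ (i : ι) {p q : B} (γ : Path p q), (∀ t, γ t ∈ U i) → ∀ w,
      m (Path.Homotopic.Quotient.mk γ) w = h i q * (h i p)⁻¹ * w := by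
  letI : TopologicalSpace G := ⊥
  haveI : DiscreteTopology G := ⟨rfl⟩
  let Z := core U hU idx hidx h hloc
  have cov : IsCoveringMap Z.proj := FiberBundle.isCoveringMap (F := G) (E := Z.Fiber)
  let mkp : ∀ (p : B) (w : G), Z.proj ⁻¹' {p} := fun p w => ⟨⟨p, (h (idx p) p)⁻¹ * w⟩, rfl⟩
  let gl : ∀ {p : B}, Z.proj ⁻¹' {p} → G := fun {p} e => h (idx e.1.1) e.1.1 * (show G from e.1.2)
  have glmk : ∀ p w, gl (mkp p w) = w := fun p w => by simp [gl, mkp]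
  have mkgl : ∀ p (e : Z.proj ⁻¹' {p}), mkp p (gl e) = e := by
    rintro p ⟨⟨p', v⟩, hv⟩
    obtain rfl : p' = p := hv
    refine Subtype.ext ?_
    show (⟨p', (h (idx p') p')⁻¹ * (h (idx p') p' * (show G from v))⟩ : Z.TotalSpace) = ⟨p', v⟩
    rw [inv_mul_cancel_left]
  refine ⟨fun {p q} γ w => gl (cov.monodromy γ (mkp p w)), ?_, ?_⟩
  · intro p q r γ γ' w
    show gl (cov.monodromy (γ.trans γ') (mkp p w)) =
      gl (cov.monodromy γ' (mkp q (gl (cov.monodromy γ (mkp p w)))))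
    rw [cov.monodromy_trans_apply, mkgl]
  · intro i p q γ hγ w
    let v : G := (h i p)⁻¹ * w
    have hc : Continuous fun t => (Z.localTriv i).toOpenPartialHomeomorph.symm (γ t, v) := by
      refine (Z.localTriv i).toOpenPartialHomeomorph.symm.continuousOn.comp_continuous (by fun_prop) ?_
      intro t
      exact (Z.mem_localTriv_target i _).2 (hγ t)
    have key : ∀ b, (⟨b, (h (idx b) b)⁻¹ * h i b * v⟩ : Z.TotalSpace) =
      (mkp b (h i b * v)).1 := fun b => by simp [mkp, mul_assoc]
    let Γ : Path (mkp p (h i p * v)).1 (mkp q (h i q * v)).1 :=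
      { toFun := fun t => (Z.localTriv i).toOpenPartialHomeomorph.symm (γ t, v)
        continuous_toFun := hc
        source' := by rw [← key]; simp only [γ.source]; rfl
        target' := by rw [← key]; simp only [γ.target]; rfl }
    have h2 : cov.monodromy (Path.Homotopic.Quotient.mk γ) (mkp p (h i p * v)) =
        mkp q (h i q * v) := by
      refine cov.monodromy_eq_of_map_eq (Path.Homotopic.Quotient.mk Γ) ?_
      refine congr_arg Path.Homotopic.Quotient.mk ?_
      ext1
      rfl
    have h3 : h i p * v = w := by simp [v]
    rw [h3] at h2
    show gl (cov.monodromy _ _) = _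
    rw [h2, glmk]
    simp [v, mul_assoc]

end UR

namespace UR
variable {n : ℕ}

/-! ### the covering of the model -/

def UU (F : Nest n) : Set (XT n) :=
  {p | (∀ i j, F.F i j → ‖p.1.2.1 i - p.1.2.1 j‖ < p.1.2.2 j - p.1.2.2 i) ∧
    ∀ i j, i < j → ¬ F.F i j →
      p.1.1 i ≠ p.1.1 j ∨ p.1.2.2 i + p.1.2.2 j < ‖p.1.2.1 i - p.1.2.1 j‖}

lemma UU_open (F : Nest n) : IsOpen (UU F) := by
  have : UU F = (⋂ i, ⋂ j, {p : XT n | F.F i j →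
        ‖p.1.2.1 i - p.1.2.1 j‖ < p.1.2.2 j - p.1.2.2 i}) ∩
      ⋂ i, ⋂ j, {p : XT n | (i < j ∧ ¬ F.F i j) →
      p.1.1 i ≠ p.1.1 j ∨ p.1.2.2 i + p.1.2.2 j < ‖p.1.2.1 i - p.1.2.1 j‖} := by
    ext p; simp [UU]
  rw [this]
  refine IsOpen.inter (isOpen_iInter_of_finite fun i => isOpen_iInter_of_finite fun j => ?_)
    (isOpen_iInter_of_finite fun i => isOpen_iInter_of_finite fun j => ?_)
  · by_cases h : F.F i j
    · simp only [h, true_imp_iff]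
      exact isOpen_lt (by fun_prop) (by fun_prop)
    · simp [h]
  · by_cases h : i < j ∧ ¬ F.F i j
    · simp only [h, true_imp_iff, not_false_eq_true, and_self]
      have h1 : IsOpen {p : XT n | p.1.1 i ≠ p.1.1 j} :=
        isOpen_ne_fun (by fun_prop) (by fun_prop)
      have h2 : IsOpen {p : XT n | p.1.2.2 i + p.1.2.2 j < ‖p.1.2.1 i - p.1.2.1 j‖} :=
        isOpen_lt (by fun_prop) (by fun_prop)
      exact h1.union h2
    · simp [h]

def FF (p : XT n) : Nest n where
  F i j := i < j ∧ p.1.1 i = p.1.1 j ∧ ‖p.1.2.1 i - p.1.2.1 j‖ < p.1.2.2 j - p.1.2.2 i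
  lt h := h.1
  tr {i j k} h1 h2 := by
    refine ⟨h1.1.trans h2.1, h1.2.1.trans h2.2.1, ?_⟩
    have := norm_sub_le_norm_sub_add_norm_sub (p.1.2.1 i) (p.1.2.1 j) (p.1.2.1 k)
    linarith [h1.2.2, h2.2.2]
  ch {i j k} h1 h2 h3 := by
    have hx : p.1.1 j = p.1.1 k := h1.2.1.symm.trans h2.2.1
    refine ⟨h3, hx, (p.2.2.2 j k h3 hx).resolve_right fun h => ?_⟩
    have := norm_sub_le_norm_sub_add_norm_sub (p.1.2.1 j) (p.1.2.1 i) (p.1.2.1 k)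
    have h4 := h1.2.2
    rw [norm_sub_rev] at h4
    linarith [h2.2.2, p.2.1 i]

lemma mem_UU_FF (p : XT n) : p ∈ UU (FF p) := by
  refine ⟨fun i j h => h.2.2, fun i j hij h => ?_⟩
  by_cases hx : p.1.1 i = p.1.1 j
  · exact Or.inr ((p.2.2.2 i j hij hx).resolve_left fun h' => h ⟨hij, hx, h'⟩)
  · exact Or.inl hx

lemma FF_iff {F : Nest n} {p : XT n} (hp : p ∈ UU F) (i j : Fin n) :
    (FF p).F i j ↔ F.F i j ∧ p.1.1 i = p.1.1 j := by
  constructor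
  · rintro ⟨h1, h2, h3⟩
    refine ⟨?_, h2⟩
    by_contra h
    rcases hp.2 i j h1 h with h4 | h4
    · exact h4 h2
    · linarith [p.2.1 i]
  · rintro ⟨h1, h2⟩
    exact ⟨F.lt h1, h2, hp.1 i j h1⟩

lemma hh_loc (F F' : Nest n) (p : XT n) (h : p ∈ UU F) (h' : p ∈ UU F') :
    ∀ᶠ q : XT n in nhds p, (hh F'.F q.1.1)⁻¹ * hh F.F q.1.1 = (hh F'.F p.1.1)⁻¹ * hh F.F p.1.1 := by
  have : ∀ᶠ q : XT n in nhds p, ∀ i j, p.1.1 i < p.1.1 j → q.1.1 i < q.1.1 j := by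
    refine Filter.eventually_all.2 fun i => Filter.eventually_all.2 fun j => ?_
    by_cases hij : p.1.1 i < p.1.1 j
    · simp only [hij, true_imp_iff]
      exact (isOpen_lt (f := fun q : XT n => q.1.1 i) (g := fun q : XT n => q.1.1 j)
        (by fun_prop) (by fun_prop)).mem_nhds hij
    · simp [hij]
  filter_upwards [this] with q hq
  rw [hh_mul F (FF p).F q.1.1 p.1.1 hq (FF_iff h), hh_mul F' (FF p).F q.1.1 p.1.1 hq (FF_iff h')]
  group

def N0 : Nest n where
  F _ _ := False
  lt h := h.elim
  tr h := h.elim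
  ch h := h.elim

def N1 {i j : Fin n} (hij : i < j) : Nest n where
  F a b := a = i ∧ b = j
  lt := by rintro a b ⟨rfl, rfl⟩; exact hij
  tr := by rintro a b c ⟨rfl, rfl⟩ ⟨h, rfl⟩; exact absurd h hij.ne'
  ch := by rintro a b c ⟨rfl, rfl⟩ ⟨-, rfl⟩ h; exact absurd h (lt_irrefl _)

lemma Cell_sub_UU {F : Nest n} {a : Fin n → Fin n → Cond}
    (h : ∀ i j, i < j → (F.F i j ↔ a i j = .inn)) (p : XT n) (hp : p.1 ∈ Cell a) : p ∈ UU F := by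
  refine ⟨fun i j hF => ?_, fun i j hij hF => ?_⟩
  · have := hp.2.2 i j (F.lt hF)
    rw [(h i j (F.lt hF)).1 hF] at this
    exact this
  · have := hp.2.2 i j hij
    rw [h i j hij] at hF
    rcases ha : a i j with _ | _ | _ | u
    · rw [ha] at this; exact Or.inl (ne_of_lt this)
    · rw [ha] at this; exact Or.inl (ne_of_gt this)
    · exact absurd ha hF
    · rw [ha] at this
      exact Or.inr (this.2.trans_le (dot_le u _ this.1))

lemma vCell_ne (u : ℂ) (c : Fin n → ℤ) (i j : Fin n) : vCell u c i j ≠ .inn := by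
  unfold vCell; split_ifs <;> simp

lemma ordCell_ne (x : Fin n → ℝ) (i j : Fin n) : ordCell x i j ≠ .inn := by
  unfold ordCell; split_ifs <;> simp

/-- Monodromy action of the fundamental groupoid. -/
lemma exists_mon' : ∃ m : ∀ {p q : XT n}, (fg p ⟶ fg q) → GP n → GP n,
    (∀ {p q r : XT n} (γ : fg p ⟶ fg q) (γ' : fg q ⟶ fg r) (w : GP n),
      m (γ ≫ γ') w = m γ' (m γ w)) ∧
    (∀ (p : XT n) w, m (𝟙 (fg p)) w = w) ∧
    ∀ (F : Nest n) (a) {p q : XT n} (hp : p.1 ∈ Cell a) (hq : q.1 ∈ Cell a),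
      (∀ i j, i < j → (F.F i j ↔ a i j = .inn)) → ∀ w,
      m (sc ⟨a, hp, hq⟩) w = hh F.F q.1.1 * (hh F.F p.1.1)⁻¹ * w := by
  obtain ⟨m, h1, h2⟩ := exists_mon (B := XT n) (G := GP n) (ι := Nest n) UU UU_open FF mem_UU_FF
    (fun F p => hh F.F p.1.1) (fun F F' p h h' => hh_loc F F' p h h')
  refine ⟨fun {p q} γ => m (p := p) (q := q) γ, fun {p q r} γ γ' w => h1 (p := p) γ γ' w, ?_, ?_⟩
  · intro p w
    have := h2 (FF p) (Path.refl p) (fun _ => mem_UU_FF p) w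
    rw [mul_inv_cancel, one_mul] at this
    exact this
  · intro F a p q hp hq hF w
    rw [← mk_eq_sc a hp hq (segPath (Cell_convex a) (Cell_subset a) hp hq) (segPath_mem _ _ _ _)]
    exact h2 F _ (fun t => Cell_sub_UU hF _ (segPath_mem _ _ _ _ t)) w

lemma phi_injective : Function.Injective (phi n) := by
  obtain ⟨m, hm, h1, hc⟩ := exists_mon' (n := n)
  have hN0 : ∀ x : Fin n → ℝ, hh N0.F x = 1 := hh_empty
  have htau : ∀ (p : GX n) w, m (tau p) w = w := by
    intro p w
    rw [tau, hm, hc N0 (p := x0) (q := vpt p.x) bCell (mem_bCell _) (mem_bCell _)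
      (fun i j _ => ⟨False.elim, fun h => vCell_ne _ _ _ _ h⟩),
      hc N0 (p := vpt p.x) (ordCell p.x) p.vmem_ord p.mem_ord
      (fun i j _ => ⟨False.elim, fun h => ordCell_ne _ _ _ h⟩)]
    simp [hN0]
  have hitau : ∀ (p : GX n) w, m (inv (tau p)) w = w := by
    intro p w
    conv_lhs => rw [← htau p w]
    rw [← hm, IsIso.hom_inv_id, h1]
  have halpha : ∀ i j (h : i < j) w, m (alpha i j h) w = gg i j h * w := by
    intro i j h w
    rw [alpha, psi, hm, hm, htau, hitau]
    have := hc (N1 h) (dCell i j .inn) (p := (cpt h xid xid_inj).1) (q := (cpt h _ nxid_inj).1)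
      (mem_inn h _) (mem_inn h _) ?_ w
    · refine this.trans ?_
      have hlt : (xid i : ℝ) < xid j := by
        simp only [xid]; exact_mod_cast h
      have e1 : hh (N1 h).F xid = 1 := by
        refine (hh_single h _).trans (if_neg hlt.not_gt)
      have e2 : hh (N1 h).F (fun i => - xid i) = gg i j h := by
        refine (hh_single h _).trans (if_pos (neg_lt_neg hlt))
      show hh (N1 h).F (fun i => - xid i) * (hh (N1 h).F xid)⁻¹ * w = _
      rw [e1, e2, inv_one, mul_one]
    · intro a b _
      unfold dCell N1
      split_ifs with h'
      · simp [h']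
      · simp only [h', false_iff]; exact vCell_ne _ _ _ _
  have hmul : ∀ (a b : FundamentalGroup (XT n) x0) w,
      m (p := x0) (q := x0) (a * b) w = m (p := x0) (q := x0) a (m (p := x0) (q := x0) b w) :=
    fun a b w => hm (p := x0) (q := x0) (r := x0) b a w
  have hone : ∀ w, m (p := x0 (n := n)) (q := x0) (1 : FundamentalGroup (XT n) x0) w = w :=
    fun w => h1 x0 w
  have main : ∀ g : GP n, ∀ w, m (p := x0) (q := x0) (phi n g) w = g * w := by
    intro g
    obtain ⟨f, rfl⟩ := PresentedGroup.mk_surjective _ g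
    induction f using FreeGroup.induction_on with
    | C1 => intro w; rw [map_one, map_one, hone, one_mul]
    | of a => 
      intro w
      have h2 := halpha _ _ a.2 w
      rw [← phi_gg] at h2
      exact h2
    | inv_of a ih =>
      intro w
      have e : PresentedGroup.mk (urltRels n) (FreeGroup.of a)⁻¹
        = (PresentedGroup.mk (urltRels n) (FreeGroup.of a))⁻¹ := map_inv _ _
      have h3 := ih ((PresentedGroup.mk (urltRels n) (FreeGroup.of a))⁻¹ * w)
      rw [mul_inv_cancel_left] at h3
      rw [e, map_inv]
      conv_lhs => rw [← h3]
      rw [← hmul, inv_mul_cancel, hone]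
    | mul a b iha ihb =>
      intro w
      rw [map_mul, map_mul, hmul, ihb, iha, mul_assoc]
  rw [injective_iff_map_eq_one]
  intro g hg
  have := main g 1
  rw [hg, hone, mul_one] at this
  exact this.symm

/-- The fundamental group of the model. -/
def phiEquiv (n : ℕ) : PresentedGroup (urltRels n) ≃* FundamentalGroup (XT n) x0 :=
  MulEquiv.ofBijective (phi n) ⟨phi_injective, phi_surjective⟩

end UR

namespace UR
variable {n : ℕ}

/-! ### geometry of circles in space -/

lemma exists_perp (w : E3) : ∃ u : E3, u ≠ 0 ∧ inner ℝ u w = (0 : ℝ) := by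
  by_cases h : w 0 = 0 ∧ w 1 = 0
  · refine ⟨!₂[1, 0, 0], fun e => ?_, ?_⟩
    · have := congr_arg (fun v : E3 => v 0) e
      simp at this
    · simp [PiLp.inner_apply, Fin.sum_univ_three, h.1]
  · refine ⟨!₂[-w 1, w 0, 0], fun e => h ?_, ?_⟩
    · have h0 := congr_arg (fun v : E3 => v 0) e
      have h1 := congr_arg (fun v : E3 => v 1) e
      simp at h0 h1
      exact ⟨h1, h0⟩
    · simp [PiLp.inner_apply, Fin.sum_univ_three]; ring

lemma exists_perp_norm (w : E3) (r : ℝ) (hr : 0 ≤ r) :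
    ∃ u : E3, ‖u‖ = r ∧ inner ℝ u w = (0 : ℝ) := by
  obtain ⟨u, hu, h⟩ := exists_perp w
  refine ⟨(r / ‖u‖) • u, ?_, ?_⟩
  · rw [norm_smul, Real.norm_of_nonneg (by positivity), div_mul_cancel₀ _ (norm_ne_zero_iff.2 hu)]
  · rw [real_inner_smul_left, h, mul_zero]

lemma mem_pCircle_add {c w u : E3} : c + u ∈ pCircle (c, w) ↔ ‖u‖ = ‖w‖ ∧ inner ℝ u w = (0 : ℝ) := by
  simp [pCircle, circleSet]

lemma pCircle_aux {c w c' w' : E3} (h : pCircle (c, w) = pCircle (c', w')) {u : E3}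
    (hu : ‖u‖ = ‖w‖) (huw : inner ℝ u w = (0 : ℝ)) :
    inner ℝ u w' = (0 : ℝ) ∧ ‖c - c'‖ ^ 2 + ‖w‖ ^ 2 = ‖w'‖ ^ 2 := by
  have h1 : c + u ∈ pCircle (c', w') := h ▸ mem_pCircle_add.2 ⟨hu, huw⟩
  have h2 : c + -u ∈ pCircle (c', w') :=
    h ▸ mem_pCircle_add.2 ⟨by rwa [norm_neg], by rw [inner_neg_left, huw, neg_zero]⟩
  obtain ⟨a1, b1⟩ := h1
  obtain ⟨a2, b2⟩ := h2
  have e1 : c + u - c' = (c - c') + u := by abel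
  have e2 : c + -u - c' = (c - c') - u := by abel
  simp only at a1 b1 a2 b2
  rw [e1] at a1 b1
  rw [e2] at a2 b2
  rw [inner_add_left] at b1
  rw [inner_sub_left] at b2
  refine ⟨by linarith, ?_⟩
  have p1 := norm_add_sq_real (c - c') u
  have p2 := norm_sub_sq_real (c - c') u
  rw [a1] at p1
  rw [a2] at p2
  rw [hu] at p1 p2
  linarith

lemma pCircle_inj {c w c' w' : E3} (hw : w ≠ 0) (hw' : w' ≠ 0)
    (h : pCircle (c, w) = pCircle (c', w')) : c' = c ∧ (w' = w ∨ w' = -w) := by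
  obtain ⟨u, hu, huw⟩ := exists_perp_norm w ‖w‖ (norm_nonneg _)
  obtain ⟨u', hu', huw'⟩ := exists_perp_norm w' ‖w'‖ (norm_nonneg _)
  have h1 := (pCircle_aux h hu huw).2
  have h2 := (pCircle_aux h.symm hu' huw').2
  have hc : ‖c - c'‖ ^ 2 = 0 := by
    rw [norm_sub_rev c' c] at h2
    nlinarith [sq_nonneg ‖c - c'‖]
  have hr : ‖w‖ = ‖w'‖ := by
    rw [hc, zero_add] at h1
    exact (sq_eq_sq₀ (norm_nonneg _) (norm_nonneg _)).1 h1
  have hc' : c = c' := by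
    rw [sq_eq_zero_iff, norm_eq_zero, sub_eq_zero] at hc
    exact hc
  refine ⟨hc'.symm, ?_⟩
  set a : ℝ := inner ℝ w' w / ‖w‖ ^ 2 with ha
  have hwn : ‖w‖ ^ 2 ≠ 0 := by positivity
  set v : E3 := w' - a • w with hv
  have hvw : inner ℝ v w = (0 : ℝ) := by
    rw [hv, inner_sub_left, real_inner_smul_left, real_inner_self_eq_norm_sq, ha,
      div_mul_cancel₀ _ hwn, sub_self]
  have hv0 : v = 0 := by
    by_contra hne
    have hvn : ‖v‖ ≠ 0 := norm_ne_zero_iff.2 hne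
    have := (pCircle_aux h (u := (‖w‖ / ‖v‖) • v) (by
      rw [norm_smul, Real.norm_of_nonneg (by positivity), div_mul_cancel₀ _ hvn])
      (by rw [real_inner_smul_left, hvw, mul_zero])).1
    rw [real_inner_smul_left] at this
    have h3 : ‖w‖ / ‖v‖ ≠ 0 := div_ne_zero (norm_ne_zero_iff.2 hw) hvn
    have h4 : inner ℝ v w' = (0 : ℝ) := (mul_eq_zero.1 this).resolve_left h3
    have h5 : inner ℝ v v = (0 : ℝ) := by
      conv_lhs => rw [hv]
      rw [inner_sub_left, real_inner_smul_left, real_inner_comm, h4, real_inner_comm, hvw]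
      simp
    exact hne (inner_self_eq_zero.1 h5)
  have hw'a : w' = a • w := sub_eq_zero.1 hv0
  have habs : |a| = 1 := by
    have : ‖w'‖ = |a| * ‖w‖ := by
      conv_lhs => rw [hw'a]
      rw [norm_smul, Real.norm_eq_abs]
    rw [← hr] at this
    have hn : ‖w‖ ≠ 0 := norm_ne_zero_iff.2 hw
    field_simp at this
    linarith
  rcases (abs_eq zero_le_one).1 habs with h | h
  · left; rw [hw'a, h, one_smul]
  · right; rw [hw'a, h, neg_smul, one_smul]

lemma pCircle_nonempty (p : E3 × E3) : (pCircle p).Nonempty := by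
  obtain ⟨u, hu, h⟩ := exists_perp_norm p.2 ‖p.2‖ (norm_nonneg _)
  exact ⟨p.1 + u, mem_pCircle_add.2 ⟨hu, h⟩⟩

/-- signs act on normal vectors -/
def sg (b : Bool) : ℝ := if b then 1 else -1

lemma norm_sg (b : Bool) (w : E3) : ‖sg b • w‖ = ‖w‖ := by
  cases b <;> simp [sg]

lemma pCircle_sg (c w : E3) (b : Bool) : pCircle (c, sg b • w) = pCircle (c, w) := by
  ext x
  cases b <;> simp [pCircle, circleSet, sg]

lemma pDisk_sg (c w : E3) (b : Bool) : pDisk (c, sg b • w) = pDisk (c, w) := by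
  ext x
  cases b <;> simp [pDisk, diskSet, sg]

def actF (σ : Equiv.Perm (Fin n)) (ε : Fin n → Bool) (f : Fin n → E3 × E3) (i : Fin n) : E3 × E3 :=
  ((f (σ i)).1, sg (ε i) • (f (σ i)).2)

lemma actF_ring (σ : Equiv.Perm (Fin n)) (ε : Fin n → Bool) {f : Fin n → E3 × E3}
    (hf : IsRingTuple f) : IsRingTuple (actF σ ε f) := by
  refine ⟨fun i h => ?_, fun i j hij => ?_, fun i j hij => ?_⟩
  · have := norm_sg (ε i) (f (σ i)).2
    simp only [actF] at h
    rw [h, norm_zero] at this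
    exact hf.1 (σ i) (norm_eq_zero.1 this.symm)
  · simp only [actF, pCircle_sg]
    exact hf.2.1 _ _ (σ.injective.ne hij)
  · simp only [actF, UnlinkedPair, LinksOnce, pCircle_sg, pDisk_sg]
    exact hf.2.2 _ _ (σ.injective.ne hij)

def act (σ : Equiv.Perm (Fin n)) (ε : Fin n → Bool) (f : RingTuple n) : RingTuple n :=
  ⟨actF σ ε f.1, actF_ring σ ε f.2⟩

lemma continuous_act (σ : Equiv.Perm (Fin n)) (ε : Fin n → Bool) :
    Continuous (act σ ε : RingTuple n → RingTuple n) := by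
  refine Continuous.subtype_mk ?_ _
  refine continuous_pi fun i => ?_
  have h : Continuous fun f : RingTuple n => f.1 (σ i) :=
    (continuous_apply (σ i)).comp continuous_subtype_val
  have h2 : Continuous ((fun _ => sg (ε i)) • fun f : RingTuple n => (f.1 (σ i)).2) :=
    Continuous.smul continuous_const h.snd
  exact Continuous.prodMk h.fst h2

abbrev πR (f : RingTuple n) : RingConf n := Quotient.mk (ringSetoid n) f

lemma πR_eq {f g : RingTuple n} : πR f = πR g ↔
    (Set.range fun i => pCircle (f.1 i)) = Set.range fun i => pCircle (g.1 i) := Quotient.eq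

lemma π_act (σ : Equiv.Perm (Fin n)) (ε : Fin n → Bool) (f : RingTuple n) : πR (act σ ε f) = πR f := by
  rw [πR_eq]
  have : (fun i => pCircle ((act σ ε f).1 i)) = (fun i => pCircle (f.1 i)) ∘ σ := by
    funext i
    simp only [act, actF, pCircle_sg, Function.comp]
  rw [this, Set.range_comp, σ.surjective.range_eq, Set.image_univ]

lemma exists_act {f g : RingTuple n} (h : πR f = πR g) : ∃ σ ε, act σ ε f = g := by
  rw [πR_eq] at h
  have h1 : ∀ i, ∃ j, pCircle (f.1 j) = pCircle (g.1 i) := fun i => by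
    have : pCircle (g.1 i) ∈ Set.range fun i => pCircle (g.1 i) := ⟨i, rfl⟩
    rw [← h] at this
    exact this
  choose s hs using h1
  have hinj : Function.Injective s := by
    intro i i' e
    by_contra hne
    have hd := g.2.2.1 i i' hne
    rw [← hs i, ← hs i', e] at hd
    exact (pCircle_nonempty (f.1 (s i'))).ne_empty (disjoint_self.1 hd)
  have hbij := Finite.injective_iff_bijective.1 hinj
  have hp : ∀ i, ∃ b : Bool, (g.1 i).1 = (f.1 (s i)).1 ∧ (g.1 i).2 = sg b • (f.1 (s i)).2 := by
    intro i
    obtain ⟨e1, e2⟩ := pCircle_inj (f.2.1 (s i)) (g.2.1 i) (hs i)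
    rcases e2 with e2 | e2
    · exact ⟨true, e1, by simp [sg, e2]⟩
    · exact ⟨false, e1, by simp [sg, e2]⟩
  choose ε hε using hp
  refine ⟨Equiv.ofBijective s hbij, ε, Subtype.ext (funext fun i => ?_)⟩
  exact Prod.ext (hε i).1.symm (hε i).2.symm

lemma πR_open : IsOpenMap (πR : RingTuple n → RingConf n) := by
  intro W hW
  rw [← isQuotientMap_quotient_mk'.isOpen_preimage, isOpen_iff_mem_nhds]
  rintro f ⟨g, hg, hgf⟩
  obtain ⟨σ, ε, e⟩ := exists_act hgf.symm
  have hn : (act σ ε) ⁻¹' W ∈ nhds f :=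
    (hW.preimage (continuous_act σ ε)).mem_nhds (by rw [Set.mem_preimage, e]; exact hg)
  refine Filter.mem_of_superset hn fun f' hf' => ?_
  exact ⟨_, hf', π_act σ ε f'⟩

end UR

namespace UR
variable {n : ℕ}

def prj (y : E3) : ℂ := ⟨y 1, y 2⟩
def em (x : ℝ) (z : ℂ) : E3 := !₂[x, z.re, z.im]

@[simp] lemma prj_em (x : ℝ) (z : ℂ) : prj (em x z) = z := by
  simp [prj, em]
@[simp] lemma em_zero (x : ℝ) (z : ℂ) : em x z 0 = x := by
  simp [em]
@[simp] lemma em_one (x : ℝ) (z : ℂ) : em x z 1 = z.re := by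
  simp [em]
@[simp] lemma em_two (x : ℝ) (z : ℂ) : em x z 2 = z.im := by
  simp [em]

lemma continuous_prj : Continuous prj := by
  have : prj = fun y => (y 1 : ℂ) + (y 2 : ℂ) * Complex.I := by
    funext y
    apply Complex.ext <;> simp [prj]
  rw [this]
  fun_prop

lemma em_ext {a b : E3} (h0 : a 0 = b 0) (h : prj a = prj b) : a = b := by
  have h1 := congrArg Complex.re h
  have h2 := congrArg Complex.im h
  ext i
  fin_cases i
  · exact h0
  · exact h1
  · exact h2

lemma continuous_em {X : Type*} [TopologicalSpace X] {f : X → ℝ} {g : X → ℂ}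
    (hf : Continuous f) (hg : Continuous g) : Continuous fun x => em (f x) (g x) := by
  unfold em
  refine (PiLp.continuous_toLp 2 _).comp (continuous_pi fun i => ?_)
  fin_cases i
  · exact hf
  · exact Complex.continuous_re.comp hg
  · exact Complex.continuous_im.comp hg

lemma norm_of_zero {u : E3} (h : u 0 = 0) : ‖u‖ = ‖prj u‖ := by
  have h1 : ‖u‖ ^ 2 = ‖prj u‖ ^ 2 := by
    rw [EuclideanSpace.real_norm_sq_eq, ← Complex.normSq_eq_norm_sq, Complex.normSq_apply,
      Fin.sum_univ_three, h]
    simp only [prj]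
    ring
  exact (pow_left_inj₀ (norm_nonneg _) (norm_nonneg _) two_ne_zero).1 h1

lemma prj_sub (a b : E3) : prj (a - b) = prj a - prj b := by
  apply Complex.ext <;> simp [prj]

lemma inner_un {w : E3} (h1 : w 1 = 0) (h2 : w 2 = 0) (hw : w ≠ 0) (u : E3) :
    inner ℝ u w = (0 : ℝ) ↔ u 0 = 0 := by
  have h0 : w 0 ≠ 0 := by
    intro h
    apply hw
    ext i
    fin_cases i
    · exact h
    · exact h1
    · exact h2
  rw [PiLp.inner_apply, Fin.sum_univ_three, h1, h2]
  simp [h0]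

lemma mem_circ {c w : E3} (h1 : w 1 = 0) (h2 : w 2 = 0) (hw : w ≠ 0) (y : E3) :
    y ∈ pCircle (c, w) ↔ y 0 = c 0 ∧ ‖prj y - prj c‖ = ‖w‖ := by
  show (‖y - c‖ = ‖w‖ ∧ inner ℝ (y - c) w = (0 : ℝ)) ↔ _
  rw [inner_un h1 h2 hw, PiLp.sub_apply, sub_eq_zero]
  constructor
  · rintro ⟨a, b⟩
    refine ⟨b, ?_⟩
    rw [← prj_sub, ← norm_of_zero (by simp [b]), a]
  · rintro ⟨a, b⟩
    refine ⟨?_, a⟩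
    rw [norm_of_zero (by simp [a]), prj_sub, b]

lemma mem_disk {c w : E3} (h1 : w 1 = 0) (h2 : w 2 = 0) (hw : w ≠ 0) (y : E3) :
    y ∈ pDisk (c, w) ↔ y 0 = c 0 ∧ ‖prj y - prj c‖ ≤ ‖w‖ := by
  show (‖y - c‖ ≤ ‖w‖ ∧ inner ℝ (y - c) w = (0 : ℝ)) ↔ _
  rw [inner_un h1 h2 hw, PiLp.sub_apply, sub_eq_zero]
  constructor
  · rintro ⟨a, b⟩
    refine ⟨b, ?_⟩
    rw [← prj_sub, ← norm_of_zero (by simp [b])]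
    exact a
  · rintro ⟨a, b⟩
    refine ⟨?_, a⟩
    rw [norm_of_zero (by simp [a]), prj_sub]
    exact b

def tF (p : Cfg n) (i : Fin n) : E3 × E3 := (em (p.1 i) (p.2.1 i), em (p.2.2 i) 0)

lemma norm_emr {r : ℝ} (hr : 0 < r) : ‖em r 0‖ = r := by
  have h1 : ‖em r 0‖ ^ 2 = r ^ 2 := by
    rw [EuclideanSpace.real_norm_sq_eq, Fin.sum_univ_three]
    simp
  exact (pow_left_inj₀ (norm_nonneg _) hr.le two_ne_zero).1 h1

lemma emr_ne {r : ℝ} (hr : 0 < r) : em r 0 ≠ 0 := by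
  intro h
  have := norm_emr hr
  rw [h, norm_zero] at this
  exact hr.ne this

lemma mem_circ_t {p : Cfg n} (hp : p ∈ XSet n) (i : Fin n) (y : E3) :
    y ∈ pCircle (tF p i) ↔ y 0 = p.1 i ∧ ‖prj y - p.2.1 i‖ = p.2.2 i := by
  unfold tF
  rw [mem_circ (by simp) (by simp) (emr_ne (hp.1 i)), norm_emr (hp.1 i)]
  simp

lemma mem_disk_t {p : Cfg n} (hp : p ∈ XSet n) (i : Fin n) (y : E3) :
    y ∈ pDisk (tF p i) ↔ y 0 = p.1 i ∧ ‖prj y - p.2.1 i‖ ≤ p.2.2 i := by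
  unfold tF
  rw [mem_disk (by simp) (by simp) (emr_ne (hp.1 i)), norm_emr (hp.1 i)]
  simp

lemma tF_disj {p : Cfg n} (hp : p ∈ XSet n) {i j : Fin n} (hij : i < j) {y : E3}
    (h : y ∈ pCircle (tF p i)) (h' : y ∈ pCircle (tF p j)) : False := by
  rw [mem_circ_t hp] at h h'
  have t1 := norm_sub_le_norm_sub_add_norm_sub (p.2.1 i) (prj y) (p.2.1 j)
  have t2 := norm_sub_le_norm_sub_add_norm_sub (prj y) (p.2.1 i) (p.2.1 j)
  rw [norm_sub_rev (p.2.1 i) (prj y)] at t1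
  rcases hp.2.2 i j hij (h.1.symm.trans h'.1) with e | e <;> linarith [h.2, h'.2]

lemma tF_ji {p : Cfg n} (hp : p ∈ XSet n) {i j : Fin n} (hij : i < j) {y : E3}
    (h : y ∈ pDisk (tF p i)) (h' : y ∈ pCircle (tF p j)) : False := by
  rw [mem_disk_t hp] at h
  rw [mem_circ_t hp] at h'
  have t1 := norm_sub_le_norm_sub_add_norm_sub (p.2.1 i) (prj y) (p.2.1 j)
  have t2 := norm_sub_le_norm_sub_add_norm_sub (prj y) (p.2.1 i) (p.2.1 j)
  rw [norm_sub_rev (p.2.1 i) (prj y)] at t1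
  rcases hp.2.2 i j hij (h.1.symm.trans h'.1) with e | e <;> linarith [h.2, h'.2]

lemma tF_ij {p : Cfg n} (hp : p ∈ XSet n) {i j : Fin n} (hij : i < j) :
    ¬ LinksOnce (tF p i) (tF p j) := by
  rintro ⟨y, ⟨h, h'⟩, hu⟩
  rw [mem_circ_t hp] at h
  rw [mem_disk_t hp] at h'
  have t1 := norm_sub_le_norm_sub_add_norm_sub (p.2.1 i) (prj y) (p.2.1 j)
  rw [norm_sub_rev (p.2.1 i) (prj y)] at t1
  have hx := h.1.symm.trans h'.1
  have e : ‖p.2.1 i - p.2.1 j‖ < p.2.2 j - p.2.2 i := by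
    rcases hp.2.2 i j hij hx with e | e
    · exact e
    · linarith [h.2, h'.2]
  have key : ∀ s : ℂ, ‖s‖ = p.2.2 i → em (p.1 i) (p.2.1 i + s) = y := by
    intro s hs
    apply hu
    constructor
    · rw [mem_circ_t hp]
      simp [hs]
    · rw [mem_disk_t hp]
      refine ⟨by simpa using hx, ?_⟩
      have : prj (em (p.1 i) (p.2.1 i + s)) - p.2.1 j = s + (p.2.1 i - p.2.1 j) := by
        rw [prj_em]; ring
      rw [this]
      have := norm_add_le s (p.2.1 i - p.2.1 j)
      linarith
  have hr := hp.1 i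
  have k1 := key (p.2.2 i : ℂ) (by simp [hr.le])
  have k2 := key (-(p.2.2 i : ℂ)) (by simp [hr.le])
  have k3 := congrArg Complex.re (congrArg prj (k1.trans k2.symm))
  simp at k3
  linarith

lemma tF_ring {p : Cfg n} (hp : p ∈ XSet n) : IsRingTuple (tF p) := by
  refine ⟨fun i => emr_ne (hp.1 i), fun i j hij => ?_, fun i j hij => ?_⟩
  · rw [Set.disjoint_left]
    intro y hy hy'
    rcases lt_or_gt_of_ne hij with h | h
    · exact tF_disj hp h hy hy'
    · exact tF_disj hp h hy' hy
  · rcases lt_or_gt_of_ne hij with h | h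
    · exact ⟨tF_ij hp h, fun ⟨y, hy, _⟩ => tF_ji hp h hy.2 hy.1⟩
    · exact ⟨fun ⟨y, hy, _⟩ => tF_ji hp h hy.2 hy.1, tF_ij hp h⟩

def tup (p : XT n) : RingTuple n := ⟨tF p.1, tF_ring p.2⟩

lemma continuous_tup : Continuous (tup : XT n → RingTuple n) := by
  refine Continuous.subtype_mk (continuous_pi fun i => ?_) _
  unfold tF
  refine Continuous.prodMk (continuous_em ?_ ?_) (continuous_em ?_ ?_) <;> fun_prop

def SF (f : Fin n → E3 × E3) : Cfg n :=
  (fun i => (f i).1 0, fun i => prj (f i).1, fun i => ‖(f i).2‖)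

lemma continuous_SF : Continuous (fun f : RingTuple n => SF f.1) := by
  have h : ∀ i, Continuous fun f : RingTuple n => f.1 i := fun i =>
    (continuous_apply i).comp continuous_subtype_val
  refine Continuous.prodMk (continuous_pi fun i => ?_)
    (Continuous.prodMk (continuous_pi fun i => ?_) (continuous_pi fun i => ?_))
  · have := (h i).fst
    fun_prop
  · exact continuous_prj.comp (h i).fst
  · exact (h i).snd.norm

lemma SF_tup (p : XT n) : SF (tup p).1 = p.1 := by
  refine Prod.ext ?_ (Prod.ext ?_ ?_)
  · funext i; simp [SF, tup, tF]
  · funext i; simp [SF, tup, tF]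
  · funext i; exact norm_emr (p.2.1 i)

lemma SF_eq {f g : RingTuple n} (h : πR f = πR g) (hf : StrictMono (SF f.1).2.2)
    (hg : StrictMono (SF g.1).2.2) : SF f.1 = SF g.1 := by
  obtain ⟨σ, ε, rfl⟩ := exists_act h
  have e : (SF (act σ ε f).1).2.2 = (SF f.1).2.2 ∘ σ := by
    funext i
    exact norm_sg _ _
  have hσ : StrictMono σ := by
    intro i j hij
    have := hg hij
    rw [e] at this
    exact hf.lt_iff_lt.1 this
  have hid : ∀ i, σ i = i := by
    intro i
    have e2 : (σ : Fin n → Fin n) = id := by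
      refine (StrictMono.range_inj hσ strictMono_id).1 ?_
      simp [σ.surjective.range_eq]
    exact congrFun e2 i
  refine Prod.ext ?_ (Prod.ext ?_ ?_)
  · funext i; simp [SF, act, actF, hid]
  · funext i; simp [SF, act, actF, hid]
  · rw [e]; funext i; simp [hid]

/-- two circles in the plane meet when the center distance is in the right range -/
lemma circles_meet {z w : ℂ} {r s : ℝ} (hr : 0 < r) (hrs : r < s) (h1 : s - r ≤ ‖z - w‖)
    (h2 : ‖z - w‖ ≤ r + s) : ∃ u : ℂ, ‖u - z‖ = r ∧ ‖u - w‖ = s := by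
  set d := ‖z - w‖ with hd
  have hd0 : 0 < d := by linarith
  set a := (s ^ 2 - r ^ 2 - d ^ 2) / (2 * d) with ha
  have had : 2 * d * a = s ^ 2 - r ^ 2 - d ^ 2 := by rw [ha]; field_simp
  have hab : a ^ 2 ≤ r ^ 2 := by
    have q1 : a ≤ r := by
      rw [ha, div_le_iff₀ (by positivity)]
      nlinarith
    have q2 : -r ≤ a := by
      rw [ha, le_div_iff₀ (by positivity)]
      nlinarith
    nlinarith
  set b := Real.sqrt (r ^ 2 - a ^ 2) with hb
  have hb2 : b ^ 2 = r ^ 2 - a ^ 2 := Real.sq_sqrt (by linarith)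
  have hunit : ‖(z - w) / (d : ℂ)‖ = 1 := by
    rw [norm_div, Complex.norm_real, Real.norm_eq_abs, abs_of_pos hd0, ← hd, div_self hd0.ne']
  have hn : ∀ x y t : ℝ, 0 ≤ t → x ^ 2 + y ^ 2 = t ^ 2 → ‖(⟨x, y⟩ : ℂ)‖ = t := by
    intro x y t ht h
    refine (pow_left_inj₀ (norm_nonneg _) ht two_ne_zero).1 ?_
    rw [← Complex.normSq_eq_norm_sq, Complex.normSq_apply, ← h]
    ring
  have hdc : (d : ℂ) ≠ 0 := by exact_mod_cast hd0.ne'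
  refine ⟨z + ⟨a, b⟩ * ((z - w) / d), ?_, ?_⟩
  · rw [add_sub_cancel_left, norm_mul, hunit, mul_one]
    exact hn _ _ _ hr.le (by linarith)
  · have : z + (⟨a, b⟩ : ℂ) * ((z - w) / d) - w = (⟨d + a, b⟩ : ℂ) * ((z - w) / d) := by
      have e : (⟨d + a, b⟩ : ℂ) = d + ⟨a, b⟩ := by
        apply Complex.ext <;> simp
      rw [e]
      field_simp
      ring
    rw [this, norm_mul, hunit, mul_one]
    exact hn _ _ _ (by linarith) (by nlinarith)

lemma SF_mem {f : RingTuple n} (hf : IsUntwistedTuple f) (hm : StrictMono (SF f.1).2.2) :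
    SF f.1 ∈ XSet n := by
  have hpos : ∀ i, 0 < (SF f.1).2.2 i := fun i => norm_pos_iff.2 (f.2.1 i)
  refine ⟨hpos, hm, fun i j hij hx => ?_⟩
  by_contra hcon
  push Not at hcon
  obtain ⟨u, hu, hu'⟩ := circles_meet (hpos i) (hm hij) hcon.1 hcon.2
  have hdis := Set.disjoint_left.1 (f.2.2.1 i j hij.ne)
  refine @hdis (em ((f.1 i).1 0) u) ?_ ?_
  · refine (mem_circ (hf i).1 (hf i).2 (f.2.1 i) _).2 ⟨by simp, ?_⟩
    rw [prj_em]; exact hu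
  · refine (mem_circ (hf j).1 (hf j).2 (f.2.1 j) _).2 ⟨(em_zero _ _).trans hx, ?_⟩
    rw [prj_em]; exact hu'

lemma tup_SF {f : RingTuple n} (hf : IsUntwistedTuple f) (hm : StrictMono (SF f.1).2.2) :
    πR (tup ⟨SF f.1, SF_mem hf hm⟩) = πR f := by
  rw [πR_eq]
  congr 1
  funext i
  ext y
  refine (mem_circ_t (SF_mem hf hm) i y).trans ?_
  exact (mem_circ (hf i).1 (hf i).2 (f.2.1 i) y).symm

def Th (p : XT n) : ↥(URlt n) :=
  ⟨πR (tup p), tup p, rfl, fun i => by simp [tup, tF], by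
    have : (fun i => ‖((tup p).1 i).2‖) = p.1.2.2 := congrArg (fun q => q.2.2) (SF_tup p)
    rw [this]
    exact p.2.2.1.injective⟩

lemma Th_cont : Continuous (Th : XT n → ↥(URlt n)) :=
  Continuous.subtype_mk (continuous_quotient_mk'.comp continuous_tup) _

lemma SF_tup_mono (p : XT n) : StrictMono (SF (tup p).1).2.2 := by
  rw [SF_tup]; exact p.2.2.1

lemma Th_inj : Function.Injective (Th : XT n → ↥(URlt n)) := by
  intro p q h
  have h1 : πR (tup p) = πR (tup q) := congrArg Subtype.val h
  have h2 := SF_eq h1 (SF_tup_mono p) (SF_tup_mono q)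
  rw [SF_tup, SF_tup] at h2
  exact Subtype.ext h2

lemma Th_surj : Function.Surjective (Th : XT n → ↥(URlt n)) := by
  rintro ⟨x, f, rfl, hf, hinj⟩
  let σ := Tuple.sort fun i => ‖(f.1 i).2‖
  let g := act σ (fun _ => true) f
  have hg : IsUntwistedTuple g := by
    intro i
    simp [g, act, actF, sg, hf (σ i)]
  have hgr : (SF g.1).2.2 = (fun i => ‖(f.1 i).2‖) ∘ σ := by
    funext i
    exact norm_sg _ _
  have hm : StrictMono (SF g.1).2.2 := by
    rw [hgr]
    exact (Tuple.monotone_sort _).strictMono_of_injective (hinj.comp σ.injective)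
  refine ⟨⟨SF g.1, SF_mem hg hm⟩, Subtype.ext ?_⟩
  exact (tup_SF hg hm).trans (π_act _ _ _)

lemma Th_open : IsOpenMap (Th : XT n → ↥(URlt n)) := by
  rintro _ ⟨V, hV, rfl⟩
  let M : Set (RingTuple n) := ⋂ (i : Fin n) (j : Fin n) (_ : i < j),
    {f | (SF f.1).2.2 i < (SF f.1).2.2 j}
  have hM : IsOpen M := by
    refine isOpen_iInter_of_finite fun i => isOpen_iInter_of_finite fun j =>
      isOpen_iInter_of_finite fun _ => isOpen_lt ?_ ?_
    · exact (continuous_apply i).comp continuous_SF.snd.snd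
    · exact (continuous_apply j).comp continuous_SF.snd.snd
  have hMm : ∀ f, f ∈ M ↔ StrictMono (SF f.1).2.2 := by
    intro f
    simp only [M, Set.mem_iInter, Set.mem_setOf_eq]
    exact ⟨fun h i j hij => h i j hij, fun h i j hij => h hij⟩
  have hO := πR_open _ ((hV.preimage continuous_SF).inter hM)
  refine ⟨_, hO, ?_⟩
  ext x
  constructor
  · intro hx
    obtain ⟨q, rfl⟩ := Th_surj x
    obtain ⟨f, ⟨hfV, hfM⟩, e⟩ := hx
    refine ⟨q, ?_, rfl⟩
    have h2 := SF_eq e ((hMm f).1 hfM) (SF_tup_mono q)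
    rw [SF_tup] at h2
    show q.1 ∈ V
    rw [← h2]
    exact hfV
  · rintro ⟨q, hq, rfl⟩
    refine ⟨tup q, ⟨?_, (hMm _).2 (SF_tup_mono q)⟩, rfl⟩
    show SF (tup q).1 ∈ V
    rw [SF_tup]
    exact hq

def ThH (n : ℕ) : XT n ≃ₜ ↥(URlt n) :=
  (Equiv.ofBijective Th ⟨Th_inj, Th_surj⟩).toHomeomorphOfContinuousOpen Th_cont Th_open

lemma final (n : ℕ) (x : ↥(URlt n)) :
    Nonempty (FundamentalGroup (↥(URlt n)) x ≃* PresentedGroup (urltRels n)) := by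
  obtain ⟨p, rfl⟩ := Th_surj x
  let E := FundamentalGroupoidFunctor.equivOfHomotopyEquiv (ThH n).toHomotopyEquiv
  have e1 : FundamentalGroup (XT n) p ≃* FundamentalGroup (↥(URlt n)) (Th p) :=
    E.fullyFaithfulFunctor.mulEquivEnd (FundamentalGroupoid.mk p)
  have e2 : FundamentalGroup (XT n) x0 ≃* FundamentalGroup (XT n) p :=
    FundamentalGroup.fundamentalGroupMulEquivOfPath (joined_x0 p).somePath
  exact ⟨((phiEquiv n).trans (e2.trans e1)).symm⟩

end UR

/-- The fundamental group of the space of configurations of untwisted rings of pairwise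
unequal sizes is isomorphic to the group presented by the generators `α_{ij}`, `i < j`,
with the relations above. -/
theorem statement13 (n : ℕ) (x : ↥(URlt n)) :
    Nonempty (FundamentalGroup (↥(URlt n)) x ≃* PresentedGroup (urltRels n)) := by
  exact UR.final n x
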